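/- arXiv:2201.02701 — 2 statements merged into one kernel-verified Lean document; each statement's English description precedes it below -/
import Mathlib

section
/- The generalized hermitian unital H(C|R) contains a subunital of order 2 if and only if R has characteristic 2 and there exists u ∈ C \ R with u² + u + 1 = 0 (equivalently, C ≅ R[X]/(X² + X + 1)). -/
noncomputable section

/-- A line of the projective plane `PG(2,C)`: the zero set of a nonzero linear form. -/
def IsLine (C : Type*) [Field C] (ℓ : Set (Projectivization C (Fin 3 → C))) : Prop :=
  ∃ f : (Fin 3 → C) →ₗ[C] C, f ≠ 0 ∧ ℓ = {P : Projectivization C (Fin 3 → C) | f P.rep = 0}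

/-- The point set of the generalized hermitian unital `H(C|R)`:
points `[X,Y,Z]` with `σ(X)·Y + σ(Z)·Z ∈ εR`. -/
def hermSet {C : Type*} [Field C] (R : Subfield C) (σ : C →+* C) (ε : C) :
    Set (Projectivization C (Fin 3 → C)) :=
  {P | ∃ v : Fin 3 → C, ∃ hv : v ≠ 0, P = Projectivization.mk C v hv ∧
        ∃ r ∈ R, σ (v 0) * v 1 + σ (v 2) * v 2 = ε * r}

/-- A block of `H(C|R)`: the trace of a line meeting the point set in at least two points. -/
def IsHermBlock {C : Type*} [Field C] (R : Subfield C) (σ : C →+* C) (ε : C)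
    (B : Set (Projectivization C (Fin 3 → C))) : Prop :=
  ∃ ℓ, IsLine C ℓ ∧ (hermSet R σ ε ∩ ℓ).Nontrivial ∧ B = hermSet R σ ε ∩ ℓ

/-- A subunital of order `q` of `H(C|R)`: a set `U` of `q³ + 1` points of the unital
such that every block containing at least two points of `U` contains exactly
`q + 1` points of `U`. -/
def IsSubunital {C : Type*} [Field C] (R : Subfield C) (σ : C →+* C) (ε : C)
    (q : ℕ) (U : Set (Projectivization C (Fin 3 → C))) : Prop :=
  U ⊆ hermSet R σ ε ∧ U.ncard = q ^ 3 + 1 ∧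
    ∀ B, IsHermBlock R σ ε B → (B ∩ U).Nontrivial → (B ∩ U).ncard = q + 1

section HermitianForm

variable {C : Type*} [Field C] {R : Subfield C} {ε t d : C} {σ : C →+* C}

/-- The sesquilinear form underlying the equation of `H(C|R)`. -/
def hermForm (σ : C →+* C) (v w : Fin 3 → C) : C :=
  σ (v 0) * w 1 + σ (v 2) * w 2

/-- The skew-hermitian form which vanishes on the diagonal at the points of `H(C|R)`. -/
def skewForm (σ : C →+* C) (ε : C) (v w : Fin 3 → C) : C :=
  hermForm σ v w * σ ε - ε * σ (hermForm σ w v)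

/-- The one-dimensional `R`-subspace `εR` of `C`. -/
def baseLine (R : Subfield C) (ε : C) : Submodule R C :=
  Submodule.span R {ε}

theorem mem_baseLine {x : C} : x ∈ baseLine R ε ↔ ∃ r ∈ R, x = ε * r := by
  rw [baseLine, Submodule.mem_span_singleton]
  constructor
  · rintro ⟨r, rfl⟩
    exact ⟨r, r.2, mul_comm _ _⟩
  · rintro ⟨r, hr, rfl⟩
    exact ⟨⟨r, hr⟩, mul_comm _ _⟩

theorem mul_mem_baseLine {c x : C} (hc : c ∈ R) (hx : x ∈ baseLine R ε) :
    c * x ∈ baseLine R ε :=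
  (baseLine R ε).smul_mem ⟨c, hc⟩ hx

theorem mem_baseLine_of_mul {c x : C} (hc : c ∈ R) (h0 : c ≠ 0) (hx : c * x ∈ baseLine R ε) :
    x ∈ baseLine R ε := by
  simpa [h0] using mul_mem_baseLine (R.inv_mem hc) hx

/-- The vector `v` satisfies the equation of `H(C|R)`. -/
def IsHermVec (R : Subfield C) (σ : C →+* C) (ε : C) (v : Fin 3 → C) : Prop :=
  hermForm σ v v ∈ baseLine R ε

theorem hermForm_add_left (u v w : Fin 3 → C) :
    hermForm σ (u + v) w = hermForm σ u w + hermForm σ v w := by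
  simp [hermForm]; ring

theorem hermForm_add_right (u v w : Fin 3 → C) :
    hermForm σ u (v + w) = hermForm σ u v + hermForm σ u w := by
  simp [hermForm]; ring

theorem hermForm_smul_left (c : C) (v w : Fin 3 → C) :
    hermForm σ (c • v) w = σ c * hermForm σ v w := by
  simp [hermForm]; ring

theorem hermForm_smul_right (c : C) (v w : Fin 3 → C) :
    hermForm σ v (c • w) = c * hermForm σ v w := by
  simp [hermForm]; ring

theorem exists_eq_add_mul (hrank : Module.finrank R C = 2) (hε : ε ∉ R) (c : C) :
    ∃ x ∈ R, ∃ y ∈ R, c = x + y * ε := by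
  have hli : LinearIndependent R ![(1 : C), ε] := by
    rw [LinearIndependent.pair_iff' one_ne_zero]
    rintro r rfl
    refine hε ?_
    rw [Subfield.smul_def, smul_eq_mul, mul_one]
    exact r.2
  have : Module.Finite R C := Module.finite_of_finrank_pos (by omega)
  have hspan := hli.span_eq_top_of_card_eq_finrank' (by simp [hrank])
  have hc : c ∈ Submodule.span R (Set.range ![(1 : C), ε]) := hspan ▸ Submodule.mem_top
  simp only [Matrix.range_cons, Matrix.range_empty, Set.union_empty, Set.singleton_union,
    Submodule.mem_span_pair] at hc
  obtain ⟨x, y, rfl⟩ := hc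
  exact ⟨x, x.2, y, y.2, by simp [Subfield.smul_def]⟩

section Involution

variable (hrank : Module.finrank R C = 2) (hε : ε ∉ R) (ht : t ∈ R) (hd : d ∈ R)
  (hmin : ε ^ 2 - t * ε + d = 0) (hσR : ∀ r ∈ R, σ r = r) (hσε : σ ε = t - ε)

include hrank hε hσR hσε in
theorem conj_conj (ht : t ∈ R) (c : C) : σ (σ c) = c := by
  obtain ⟨x, hx, y, hy, rfl⟩ := exists_eq_add_mul hrank hε c
  simp [hσR x hx, hσR y hy, hσε, hσR t ht]

include hrank hε ht hσR hσε in
theorem add_conj_mem (c : C) : c + σ c ∈ R := by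
  obtain ⟨x, hx, y, hy, rfl⟩ := exists_eq_add_mul hrank hε c
  have : x + y * ε + σ (x + y * ε) = x + x + y * t := by
    simp [hσR x hx, hσR y hy, hσε]; ring
  rw [this]
  exact R.add_mem (R.add_mem hx hx) (R.mul_mem hy ht)

include hrank hε ht hd hmin hσR hσε in
theorem conj_mul_mem (c : C) : σ c * c ∈ R := by
  obtain ⟨x, hx, y, hy, rfl⟩ := exists_eq_add_mul hrank hε c
  have : σ (x + y * ε) * (x + y * ε) = x * x + x * y * t + y * y * d := by
    simp only [map_add, map_mul, hσR x hx, hσR y hy, hσε]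
    linear_combination (-y ^ 2) * hmin
  rw [this]
  exact R.add_mem (R.add_mem (R.mul_mem hx hx) (R.mul_mem (R.mul_mem hx hy) ht))
    (R.mul_mem (R.mul_mem hy hy) hd)

include hrank hε ht hd hmin hσR hσε in
theorem IsHermVec.smul {v : Fin 3 → C} (hv : IsHermVec R σ ε v) (c : C) :
    IsHermVec R σ ε (c • v) := by
  rw [IsHermVec, hermForm_smul_left, hermForm_smul_right, ← mul_assoc]
  exact mul_mem_baseLine (conj_mul_mem hrank hε ht hd hmin hσR hσε c) hv

include hrank hε ht hd hmin hσR hσε in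
theorem isHermVec_of_mem_hermSet {v : Fin 3 → C} (hv : v ≠ 0)
    (h : Projectivization.mk C v hv ∈ hermSet R σ ε) : IsHermVec R σ ε v := by
  obtain ⟨w, hw, heq, hr⟩ := h
  obtain ⟨c, rfl⟩ := (Projectivization.mk_eq_mk_iff' C v w hv hw).1 heq
  exact IsHermVec.smul hrank hε ht hd hmin hσR hσε (mem_baseLine.2 hr) c

theorem skewForm_add_left (u v w : Fin 3 → C) :
    skewForm σ ε (u + v) w = skewForm σ ε u w + skewForm σ ε v w := by
  simp only [skewForm, hermForm_add_left, hermForm_add_right, map_add]; ring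

theorem skewForm_add_right (u v w : Fin 3 → C) :
    skewForm σ ε u (v + w) = skewForm σ ε u v + skewForm σ ε u w := by
  simp only [skewForm, hermForm_add_left, hermForm_add_right, map_add]; ring

theorem skewForm_smul_left (c : C) (v w : Fin 3 → C) :
    skewForm σ ε (c • v) w = σ c * skewForm σ ε v w := by
  simp only [skewForm, hermForm_smul_left, hermForm_smul_right, map_mul]; ring

include hrank hε ht hσR hσε in
theorem skewForm_smul_right (c : C) (v w : Fin 3 → C) :
    skewForm σ ε v (c • w) = c * skewForm σ ε v w := by
  simp only [skewForm, hermForm_smul_left, hermForm_smul_right, map_mul,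
    conj_conj hrank hε hσR hσε ht]
  ring

include hσR in
theorem IsHermVec.skewForm_self {v : Fin 3 → C} (hv : IsHermVec R σ ε v) :
    skewForm σ ε v v = 0 := by
  obtain ⟨r, hr, h⟩ := mem_baseLine.1 hv
  rw [skewForm, h, map_mul, hσR r hr]
  ring

include hrank hε ht hd hmin hσR hσε in
theorem skewForm_mem {v w : Fin 3 → C} (h : hermForm σ v w + hermForm σ w v ∈ baseLine R ε) :
    skewForm σ ε v w ∈ R ∧ skewForm σ ε w v = - skewForm σ ε v w := by
  obtain ⟨r, hr, h⟩ := mem_baseLine.1 h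
  have h1 : hermForm σ w v = ε * r - hermForm σ v w := by rw [← h]; ring
  have h2 := add_conj_mem hrank hε ht hσR hσε (hermForm σ v w * σ ε)
  have h3 := conj_mul_mem hrank hε ht hd hmin hσR hσε ε
  have h4 : skewForm σ ε v w =
      hermForm σ v w * σ ε + σ (hermForm σ v w * σ ε) - σ ε * ε * r := by
    rw [skewForm, h1, map_sub, map_mul, map_mul, conj_conj hrank hε hσR hσε ht, hσR r hr]
    ring
  refine ⟨h4 ▸ R.sub_mem h2 (R.mul_mem h3 hr), ?_⟩
  simp only [skewForm, h1, map_sub, map_mul, hσR r hr]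
  ring

include hrank hε ht hd hmin hσR hσε in
/-- The skew-hermitian form is anisotropic on its left radical. -/
theorem eq_zero_of_skewForm_eq_zero {v : Fin 3 → C} (hv : IsHermVec R σ ε v)
    (h : ∀ w, skewForm σ ε v w = 0) : v = 0 := by
  have hε0 : ε ≠ 0 := fun h => hε (h ▸ R.zero_mem)
  have h0 := h ![0, 1, 0]
  have h1 := h ![1, 0, 0]
  simp [skewForm, hermForm, hε0] at h0 h1
  obtain ⟨r, hr, hz⟩ := mem_baseLine.1 hv
  simp only [hermForm, h0, map_zero, zero_mul, zero_add] at hz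
  have hm := conj_mul_mem hrank hε ht hd hmin hσR hσε (v 2)
  have h2 : v 2 = 0 := by
    by_cases hr0 : r = 0
    · simpa [hr0] using hz
    · refine absurd ?_ hε
      have : ε = σ (v 2) * v 2 * r⁻¹ := by rw [hz]; field_simp
      rw [this]
      exact R.mul_mem hm (R.inv_mem hr)
  ext i
  fin_cases i <;> simp [h0, h1, h2]

theorem exists_eq_combination {e₁ e₂ e₃ : Fin 3 → C} (hli : LinearIndependent C ![e₁, e₂, e₃])
    (v : Fin 3 → C) : ∃ c₁ c₂ c₃ : C, v = c₁ • e₁ + c₂ • e₂ + c₃ • e₃ := by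
  have hspan := hli.span_eq_top_of_card_eq_finrank' (by simp)
  have hc : v ∈ Submodule.span C (Set.range ![e₁, e₂, e₃]) := hspan ▸ Submodule.mem_top
  obtain ⟨c, rfl⟩ := (Submodule.mem_span_range_iff_exists_fun C).1 hc
  exact ⟨c 0, c 1, c 2, by simp [Fin.sum_univ_three]⟩

theorem eq_zero_of_combination_eq_zero {e₁ e₂ e₃ : Fin 3 → C}
    (hli : LinearIndependent C ![e₁, e₂, e₃]) {c₁ c₂ c₃ : C}
    (h : c₁ • e₁ + c₂ • e₂ + c₃ • e₃ = 0) : c₁ = 0 ∧ c₂ = 0 ∧ c₃ = 0 := by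
  have := Fintype.linearIndependent_iff.1 hli ![c₁, c₂, c₃] (by simpa [Fin.sum_univ_three] using h)
  exact ⟨this 0, this 1, this 2⟩

include hrank hε ht hσR hσε in
theorem skewForm_ne_zero_of_basis {e₁ e₂ e₃ : Fin 3 → C}
    (hli : LinearIndependent C ![e₁, e₂, e₃])
    (h₁ : ∀ w ∈ [e₁, e₂, e₃], skewForm σ ε e₁ w = 0)
    (h₂ : ∀ w ∈ [e₁, e₂, e₃], skewForm σ ε e₂ w = 0)
    (h₃ : ∀ w ∈ [e₁, e₂, e₃], skewForm σ ε e₃ w = 0) : False := by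
  have hε0 : ε ≠ 0 := fun h => hε (h ▸ R.zero_mem)
  have key : ∀ v w, skewForm σ ε v w = 0 := fun v w => by
    obtain ⟨c₁, c₂, c₃, rfl⟩ := exists_eq_combination hli v
    obtain ⟨d₁, d₂, d₃, rfl⟩ := exists_eq_combination hli w
    simp only [List.mem_cons, List.not_mem_nil, or_false, forall_eq_or_imp, forall_eq] at h₁ h₂ h₃
    simp only [skewForm_add_left, skewForm_add_right, skewForm_smul_left,
      skewForm_smul_right hrank hε ht hσR hσε, h₁, h₂, h₃]
    ring
  have := key ![1, 0, 0] ![0, 1, 0]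
  simp [skewForm, hermForm, hε0] at this

theorem hermForm_symm_mem {v w : Fin 3 → C} {a : C} (ha : a ∈ R) (ha0 : a ≠ 0)
    (hσR : ∀ r ∈ R, σ r = r) (hv : IsHermVec R σ ε v) (hw : IsHermVec R σ ε w)
    (hvw : IsHermVec R σ ε (v + a • w)) :
    hermForm σ v w + hermForm σ w v ∈ baseLine R ε := by
  refine mem_baseLine_of_mul ha ha0 ?_
  have h : a * (hermForm σ v w + hermForm σ w v) =
      hermForm σ (v + a • w) (v + a • w) - hermForm σ v v - a * (a * hermForm σ w w) := by
    simp only [hermForm_add_left, hermForm_add_right, hermForm_smul_left, hermForm_smul_right,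
      hσR a ha]
    ring
  rw [h]
  exact Submodule.sub_mem _ (Submodule.sub_mem _ hvw hv)
    (mul_mem_baseLine ha (mul_mem_baseLine ha hw))

include hrank hε ht hd hmin hσR hσε in
/-- No triangle of `H(C|R)` has a point of `H(C|R)` with coordinates in `R` on each side. -/
theorem not_isHermVec_triangle {e₁ e₂ e₃ : Fin 3 → C} {a b : C}
    (hli : LinearIndependent C ![e₁, e₂, e₃]) (ha : a ∈ R) (hb : b ∈ R) (ha0 : a ≠ 0)
    (hb0 : b ≠ 0) (h₁ : IsHermVec R σ ε e₁) (h₂ : IsHermVec R σ ε e₂) (h₃ : IsHermVec R σ ε e₃)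
    (h₁₂ : IsHermVec R σ ε (e₁ + a • e₂)) (h₁₃ : IsHermVec R σ ε (e₁ + b • e₃))
    (h₂₃ : IsHermVec R σ ε (e₂ + e₃)) : False := by
  have s₁₂ := hermForm_symm_mem ha ha0 hσR h₁ h₂ h₁₂
  have s₁₃ := hermForm_symm_mem hb hb0 hσR h₁ h₃ h₁₃
  have s₂₃ := hermForm_symm_mem R.one_mem one_ne_zero hσR h₂ h₃ (by rwa [one_smul])
  obtain ⟨m₁₂, t₁₂⟩ := skewForm_mem hrank hε ht hd hmin hσR hσε s₁₂
  obtain ⟨m₁₃, t₁₃⟩ := skewForm_mem hrank hε ht hd hmin hσR hσε s₁₃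
  obtain ⟨m₂₃, t₂₃⟩ := skewForm_mem hrank hε ht hd hmin hσR hσε s₂₃
  have t₁ := h₁.skewForm_self hσR
  have t₂ := h₂.skewForm_self hσR
  have t₃ := h₃.skewForm_self hσR
  set x := skewForm σ ε e₁ e₂
  set y := skewForm σ ε e₁ e₃
  set z := skewForm σ ε e₂ e₃
  have hrad : z • e₁ + (-y) • e₂ + x • e₃ = 0 := by
    apply eq_zero_of_skewForm_eq_zero hrank hε ht hd hmin hσR hσε
    · have h : hermForm σ (z • e₁ + (-y) • e₂ + x • e₃) (z • e₁ + (-y) • e₂ + x • e₃) =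
          z * (z * hermForm σ e₁ e₁) + y * (y * hermForm σ e₂ e₂) + x * (x * hermForm σ e₃ e₃)
          + (-y * z) * (hermForm σ e₁ e₂ + hermForm σ e₂ e₁)
          + (x * z) * (hermForm σ e₁ e₃ + hermForm σ e₃ e₁)
          + (-y * x) * (hermForm σ e₂ e₃ + hermForm σ e₃ e₂) := by
        simp only [hermForm_add_left, hermForm_add_right, hermForm_smul_left, hermForm_smul_right,
          map_neg, hσR x m₁₂, hσR y m₁₃, hσR z m₂₃]
        ring
      rw [IsHermVec, h]
      have hy := R.neg_mem m₁₃
      refine Submodule.add_mem _ (Submodule.add_mem _ (Submodule.add_mem _ (Submodule.add_mem _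
        (Submodule.add_mem _ ?_ ?_) ?_) ?_) ?_) ?_
      · exact mul_mem_baseLine m₂₃ (mul_mem_baseLine m₂₃ h₁)
      · exact mul_mem_baseLine m₁₃ (mul_mem_baseLine m₁₃ h₂)
      · exact mul_mem_baseLine m₁₂ (mul_mem_baseLine m₁₂ h₃)
      · exact mul_mem_baseLine (R.mul_mem hy m₂₃) s₁₂
      · exact mul_mem_baseLine (R.mul_mem m₁₂ m₂₃) s₁₃
      · exact mul_mem_baseLine (R.mul_mem hy m₁₂) s₂₃
    · intro w
      obtain ⟨c₁, c₂, c₃, rfl⟩ := exists_eq_combination hli w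
      simp only [skewForm_add_left, skewForm_add_right, skewForm_smul_left,
        skewForm_smul_right hrank hε ht hσR hσε, map_neg, hσR x m₁₂, hσR y m₁₃, hσR z m₂₃,
        t₁, t₂, t₃, t₁₂, t₁₃, t₂₃]
      ring
  obtain ⟨hz, hy, hx⟩ := eq_zero_of_combination_eq_zero hli hrad
  rw [neg_eq_zero] at hy
  rw [hx, neg_zero] at t₁₂
  rw [hy, neg_zero] at t₁₃
  rw [hz, neg_zero] at t₂₃
  apply skewForm_ne_zero_of_basis hrank hε ht hσR hσε hli <;>
    simp only [List.mem_cons, List.not_mem_nil, or_false, forall_eq_or_imp, forall_eq] <;>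
    exact ⟨by assumption, by assumption, by assumption⟩

include hrank hε ht hd hmin hσR hσε in
theorem char_two_of_hesse {e₁ e₂ e₃ : Fin 3 → C} {a b : C}
    (hli : LinearIndependent C ![e₁, e₂, e₃]) (hab : a + b = 1) (hab' : a * b = 1)
    (h₁ : IsHermVec R σ ε e₁) (h₂ : IsHermVec R σ ε e₂) (h₃ : IsHermVec R σ ε e₃)
    (hp : IsHermVec R σ ε (e₁ + a • e₂)) (hr : IsHermVec R σ ε (e₁ + b • e₃))
    (hq : IsHermVec R σ ε (e₂ + e₃)) (hf : IsHermVec R σ ε (e₁ + e₂ + e₃))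
    (hg : IsHermVec R σ ε (e₁ + e₂ + b • e₃)) (hh : IsHermVec R σ ε (e₁ + a • e₂ + e₃)) :
    (2 : C) = 0 ∧ a ∉ R := by
  have ha0 : a ≠ 0 := left_ne_zero_of_mul_eq_one hab'
  have hb0 : b ≠ 0 := right_ne_zero_of_mul_eq_one hab'
  have haR : a ∉ R := fun ha => by
    have hb : b ∈ R := by
      rw [show b = 1 - a by rw [← hab]; ring]
      exact R.sub_mem R.one_mem ha
    exact not_isHermVec_triangle hrank hε ht hd hmin hσR hσε hli ha hb ha0 hb0 h₁ h₂ h₃ hp hr hq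
  refine ⟨?_, haR⟩
  by_contra h2
  have hσa : σ a ≠ a := fun h => by
    have hn := conj_mul_mem hrank hε ht hd hmin hσR hσε a
    rw [h] at hn
    refine haR ?_
    have : a = 1 + a * a := by linear_combination hab' - a * hab
    rw [this]
    exact R.add_mem R.one_mem hn
  have hσab : σ a = b := by
    have h1 := congrArg σ hab
    have h2 := congrArg σ hab'
    simp only [map_add, map_mul, map_one] at h1 h2
    have : (σ a - a) * (σ a - b) = 0 := by
      linear_combination (-σ a) * hab + hab' + σ a * h1 - h2
    exact sub_eq_zero.1 ((mul_eq_zero.1 this).resolve_left (sub_ne_zero.2 hσa))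
  have hσba : σ b = a := by rw [← hσab, conj_conj hrank hε hσR hσε ht]
  have hba : b - a ≠ 0 := sub_ne_zero.2 (hσab ▸ hσa)
  have t₁ := h₁.skewForm_self hσR
  have t₂ := h₂.skewForm_self hσR
  have t₃ := h₃.skewForm_self hσR
  have tp := hp.skewForm_self hσR
  have tq := hq.skewForm_self hσR
  have tr := hr.skewForm_self hσR
  have tf := hf.skewForm_self hσR
  have tg := hg.skewForm_self hσR
  have th := hh.skewForm_self hσR
  simp only [skewForm_add_left, skewForm_add_right, skewForm_smul_left,
    skewForm_smul_right hrank hε ht hσR hσε, hσab, hσba, t₁, t₂, t₃] at tp tq tr tf tg th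
  set x := skewForm σ ε e₁ e₂
  set x' := skewForm σ ε e₂ e₁
  set y := skewForm σ ε e₁ e₃
  set y' := skewForm σ ε e₃ e₁
  set z := skewForm σ ε e₂ e₃
  set z' := skewForm σ ε e₃ e₂
  have hz0 : (2 : C) * ((b - a) * z) = 0 := by
    linear_combination tg + th - tp - tr - tf - (2 * a - 1) * tq
  have hz : z = 0 := by simpa [h2, hba] using hz0
  have hz' : z' = 0 := by linear_combination tq - hz
  have hx0 : x + x' = 0 := by linear_combination tg - tr - b * hz - a * hz'
  have hy0 : y + y' = 0 := by linear_combination th - tp - b * hz - a * hz'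
  have hx : x = 0 := by
    have : (b - a) * x = 0 := by linear_combination b * hx0 - tp
    simpa [hba] using this
  have hy : y = 0 := by
    have : (b - a) * y = 0 := by linear_combination tr - a * hy0
    simpa [hba] using this
  have hx' : x' = 0 := by linear_combination hx0 - hx
  have hy' : y' = 0 := by linear_combination hy0 - hy
  apply skewForm_ne_zero_of_basis hrank hε ht hσR hσε hli <;>
    simp only [List.mem_cons, List.not_mem_nil, or_false, forall_eq_or_imp, forall_eq] <;>
    exact ⟨by assumption, by assumption, by assumption⟩

end Involution

end HermitianForm

theorem steiner_last {α : Type*} {m : α → α → α} (inv : ∀ x y, m x (m x y) = y)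
    {a b c d e f g h i : α}
    (cover : ∀ t, t ∈ [a, b, c, d, e, f, g, h, i])
    (hbc : m a b = c) (hde : m a d = e) (hfg : m a f = g) (hh : h ∉ [a, b, c, d, e, f, g])
    (hah : a ≠ m a h) (hhh : h ≠ m a h) : m a h = i := by
  have := cover (m a h)
  simp only [List.mem_cons, List.not_mem_nil, or_false, not_or] at this hh
  grind

theorem exists_not_mem_list {α : Type*} [Finite α] (l : List α) (hl : l.length < Nat.card α) :
    ∃ t, t ∉ l := by
  classical
  by_contra! h
  have := Fintype.ofFinite α
  have h1 : l.toFinset = Finset.univ := by ext; simp [h]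
  have h2 := l.toFinset_card_le
  rw [h1, Finset.card_univ, ← Nat.card_eq_fintype_card] at h2
  omega

theorem List.Nodup.mem_of_length_eq_card {α : Type*} [Finite α] {l : List α} (hn : l.Nodup)
    (hl : l.length = Nat.card α) (t : α) : t ∈ l := by
  by_contra ht
  have := Fintype.ofFinite α
  have h1 := (List.nodup_cons.2 ⟨ht, hn⟩).length_le_card
  rw [List.length_cons, hl, Nat.card_eq_fintype_card] at h1
  omega

/-- The idempotent Steiner quasigroup of a Steiner triple system on nine points is distributive. -/
theorem steiner_distrib {α : Type*} (hcard : Nat.card α = 9) (m : α → α → α)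
    (idem : ∀ x, m x x = x) (comm : ∀ x y, m x y = m y x) (inv : ∀ x y, m x (m x y) = y)
    (x y z : α) : m x (m y z) = m (m x y) (m x z) := by
  have : Finite α := Nat.finite_of_card_ne_zero (by omega)
  by_cases hxy : x = y
  · grind
  by_cases hxz : x = z
  · grind
  by_cases hyz : y = z
  · grind
  by_cases hz : m x y = z
  · grind
  have fixed : ∀ a b, a = m a b → a = b := fun a b h => by grind
  have fixed' : ∀ a b, b = m a b → a = b := fun a b h => by grind
  obtain ⟨p, hp⟩ : ∃ p, m x y = p := ⟨_, rfl⟩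
  obtain ⟨q, hq⟩ : ∃ q, m y z = q := ⟨_, rfl⟩
  obtain ⟨r, hr⟩ : ∃ r, m x z = r := ⟨_, rfl⟩
  obtain ⟨f, hf⟩ : ∃ f, m x q = f := ⟨_, rfl⟩
  obtain ⟨w, hw⟩ : ∃ w, m p r = w := ⟨_, rfl⟩
  rw [hp, hq, hr, hf, hw]
  by_contra hne
  have d7 : [x, y, z, p, q, r, f].Nodup := by
    simp only [List.nodup_cons, List.mem_cons, List.not_mem_nil, or_false, not_or,
      List.nodup_nil, and_true, not_false_eq_true]
    refine ⟨⟨?_, ?_, ?_, ?_, ?_, ?_⟩, ⟨?_, ?_, ?_, ?_, ?_⟩, ⟨?_, ?_, ?_, ?_⟩, ⟨?_, ?_, ?_⟩,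
      ⟨?_, ?_⟩, ?_⟩ <;> grind
  have last : ∀ a b c d e f g h i, _ := fun a b c d e f g h i =>
    @steiner_last α m inv a b c d e f g h i
  simp only [List.mem_cons, List.not_mem_nil, or_false, not_or] at last
  by_cases hwq : w = q
  · obtain ⟨s, hs⟩ := exists_not_mem_list [x, y, z, p, q, r, f] (by simp [hcard])
    obtain ⟨t, ht⟩ : ∃ t, m x s = t := ⟨_, rfl⟩
    have d9 : [x, y, z, p, q, r, f, s, t].Nodup := by
      simp only [List.nodup_cons, List.mem_cons, List.not_mem_nil, or_false, not_or,
        List.nodup_nil, and_true, not_false_eq_true] at d7 hs ⊢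
      refine ⟨⟨?_, ?_, ?_, ?_, ?_, ?_, ?_, ?_⟩, ⟨?_, ?_, ?_, ?_, ?_, ?_, ?_⟩,
        ⟨?_, ?_, ?_, ?_, ?_, ?_⟩, ⟨?_, ?_, ?_, ?_, ?_⟩, ⟨?_, ?_, ?_, ?_⟩, ⟨?_, ?_, ?_⟩,
        ⟨?_, ?_⟩, ?_⟩ <;> grind
    have cov := d9.mem_of_length_eq_card (by simp [hcard])
    have hyr := cov (m y r)
    have hzp := cov (m z p)
    simp only [List.nodup_cons, List.mem_cons, List.not_mem_nil, or_false, not_or,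
      List.nodup_nil, and_true, not_false_eq_true] at d9 cov hyr hzp
    have hyf : m y r ≠ f := fun h => by
      have := last y x p z q r f s t (fun u => by have := cov u; clear * - this; tauto)
      clear hyr hzp cov
      grind
    have hzf : m z p ≠ f := fun h => by
      have := last z x r y q p f s t (fun u => by have := cov u; clear * - this; tauto)
      clear hyr hzp cov
      grind
    have hyr' : m y r = s ∨ m y r = t := by clear hzp cov; grind
    have hzp' : m z p = s ∨ m z p = t := by clear hyr cov; grind
    have hys := last y x p z q r s f t (fun u => by have := cov u; clear * - this; tauto)
    have hyt := last y x p z q r t f s (fun u => by have := cov u; clear * - this; tauto)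
    have hzs := last z x r y q p s f t (fun u => by have := cov u; clear * - this; tauto)
    have hzt := last z x r y q p t f s (fun u => by have := cov u; clear * - this; tauto)
    have hps := last p x y q r z s f t (fun u => by have := cov u; clear * - this; tauto)
    have hpt := last p x y q r z t f s (fun u => by have := cov u; clear * - this; tauto)
    clear hyr hzp cov
    rcases hyr' with h | h <;> rcases hzp' with h' | h' <;> grind
  · have d8 : [x, y, z, p, q, r, f, w].Nodup := by
      simp only [List.nodup_cons, List.mem_cons, List.not_mem_nil, or_false, not_or,
        List.nodup_nil, and_true, not_false_eq_true] at d7 ⊢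
      refine ⟨⟨?_, ?_, ?_, ?_, ?_, ?_, ?_⟩,
        ⟨?_, ?_, ?_, ?_, ?_, ?_⟩, ⟨?_, ?_, ?_, ?_, ?_⟩, ⟨?_, ?_, ?_, ?_⟩, ⟨?_, ?_, ?_⟩,
        ⟨?_, ?_⟩, ?_⟩ <;> grind
    obtain ⟨t, ht⟩ := exists_not_mem_list [x, y, z, p, q, r, f, w] (by simp [hcard])
    have d9 : [t, x, y, z, p, q, r, f, w].Nodup := List.nodup_cons.2 ⟨ht, d8⟩
    have cov := d9.mem_of_length_eq_card (by simp [hcard])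
    have hyr := cov (m y r)
    have hzp := cov (m z p)
    simp only [List.nodup_cons, List.mem_cons, List.not_mem_nil, or_false, not_or,
      List.nodup_nil, and_true, not_false_eq_true] at d9 cov hyr hzp
    clear d7 d8 ht
    have hx := last x y p z r q f w t (fun u => by have := cov u; clear * - this; tauto)
    have hyf : m y r ≠ f := fun h => by
      have := last y x p z q r f w t (fun u => by have := cov u; clear * - this; tauto)
      clear hyr hzp cov
      grind
    have hzf : m z p ≠ f := fun h => by
      have := last z x r y q p f w t (fun u => by have := cov u; clear * - this; tauto)
      clear hyr hzp cov
      grind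
    have hyr' : m y r = t := by clear hzp cov; grind
    have hzp' : m z p = t := by clear hyr cov; grind
    have hyw := last y x p z q r t f w (fun u => by have := cov u; clear * - this; tauto)
    have hzw := last z x r y q p t f w (fun u => by have := cov u; clear * - this; tauto)
    clear hyr hzp cov
    grind

section ProjectivePlane

variable {C : Type*} [Field C]

omit [Field C] in
theorem range_pair (v w : Fin 3 → C) : Set.range ![v, w] = {v, w} := by
  ext
  simp [or_comm]

theorem apply_eq_zero_iff_mem_span {f : (Fin 3 → C) →ₗ[C] C} (hf : f ≠ 0) {v w : Fin 3 → C}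
    (hli : LinearIndependent C ![v, w]) (hv : f v = 0) (hw : f w = 0) (x : Fin 3 → C) :
    f x = 0 ↔ x ∈ Submodule.span C {v, w} := by
  have hle : Submodule.span C {v, w} ≤ LinearMap.ker f := by
    rw [Submodule.span_le]
    rintro y (rfl | rfl) <;> simpa
  have h1 : Module.finrank C (Submodule.span C {v, w}) = 2 := by
    rw [← range_pair, finrank_span_eq_card hli]
    simp
  have h2 : Module.finrank C (LinearMap.ker f) = 2 := by
    have h3 := f.finrank_range_add_finrank_ker
    rw [LinearMap.range_eq_top.2 (LinearMap.surjective hf)] at h3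
    simp at h3
    omega
  rw [Submodule.eq_of_le_of_finrank_eq hle (h1.trans h2.symm), LinearMap.mem_ker]

theorem exists_linearForm_vanishing (v w : Fin 3 → C) :
    ∃ f : (Fin 3 → C) →ₗ[C] C, f ≠ 0 ∧ f v = 0 ∧ f w = 0 := by
  have hlt : Submodule.span C {v, w} < ⊤ := by
    rw [lt_top_iff_ne_top]
    intro h
    have h1 := finrank_range_le_card (R := C) ![v, w]
    rw [Set.finrank, range_pair, h, finrank_top] at h1
    simp at h1
  obtain ⟨f, hf, hle⟩ := Submodule.exists_le_ker_of_lt_top _ hlt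
  exact ⟨f, hf, hle (Submodule.subset_span (by simp)), hle (Submodule.subset_span (by simp))⟩

theorem linearIndependent_rep {P Q : Projectivization C (Fin 3 → C)} (h : P ≠ Q) :
    LinearIndependent C ![P.rep, Q.rep] := by
  rw [LinearIndependent.pair_iff' P.rep_nonzero]
  intro a ha
  refine h ?_
  rw [← P.mk_rep, ← Q.mk_rep, Projectivization.mk_eq_mk_iff']
  by_cases ha0 : a = 0
  · exact absurd (by rw [← ha, ha0, zero_smul]) Q.rep_nonzero
  · exact ⟨a⁻¹, by rw [← ha, smul_smul, inv_mul_cancel₀ ha0, one_smul]⟩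

/-- The vector `v` is a coordinate vector of the point `P`. -/
def IsCoord (v : Fin 3 → C) (P : Projectivization C (Fin 3 → C)) : Prop :=
  ∃ hv : v ≠ 0, Projectivization.mk C v hv = P

theorem isCoord_rep (P : Projectivization C (Fin 3 → C)) : IsCoord P.rep P :=
  ⟨P.rep_nonzero, P.mk_rep⟩

theorem IsCoord.smul {v : Fin 3 → C} {P : Projectivization C (Fin 3 → C)} (h : IsCoord v P)
    {c : C} (hc : c ≠ 0) : IsCoord (c • v) P := by
  obtain ⟨hv, rfl⟩ := h
  exact ⟨smul_ne_zero hc hv, (Projectivization.mk_eq_mk_iff' _ _ _ _ _).2 ⟨c, rfl⟩⟩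

theorem IsCoord.exists_smul {v w : Fin 3 → C} {P : Projectivization C (Fin 3 → C)}
    (hv : IsCoord v P) (hw : IsCoord w P) : ∃ c : C, c ≠ 0 ∧ v = c • w := by
  obtain ⟨hv, rfl⟩ := hv
  obtain ⟨hw, h⟩ := hw
  obtain ⟨c, rfl⟩ := (Projectivization.mk_eq_mk_iff' _ _ _ _ _).1 h.symm
  exact ⟨c, fun h0 => hv (by simp [h0]), rfl⟩

/-- `T` is a third point on the line joining `P` and `Q`. -/
def IsThird (P Q T : Projectivization C (Fin 3 → C)) : Prop :=
  T ≠ P ∧ T ≠ Q ∧ T.rep ∈ Submodule.span C {P.rep, Q.rep}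

theorem IsThird.exists_isCoord {P Q T : Projectivization C (Fin 3 → C)} (h : IsThird P Q T)
    {v w : Fin 3 → C} (hv : IsCoord v P) (hw : IsCoord w Q) :
    ∃ c : C, c ≠ 0 ∧ IsCoord (v + c • w) T := by
  obtain ⟨hP, hQ, hT⟩ := h
  obtain ⟨a, ha, hva⟩ := (isCoord_rep P).exists_smul hv
  obtain ⟨b, hb, hwb⟩ := (isCoord_rep Q).exists_smul hw
  obtain ⟨x, y, hxy⟩ := Submodule.mem_span_pair.1 hT
  have hT0 := T.rep_nonzero
  have hx : x ≠ 0 := by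
    rintro rfl
    rw [zero_smul, zero_add] at hxy
    refine hQ ?_
    rw [← T.mk_rep, ← Q.mk_rep, Projectivization.mk_eq_mk_iff']
    exact ⟨y, hxy⟩
  have hy : y ≠ 0 := by
    rintro rfl
    rw [zero_smul, add_zero] at hxy
    refine hP ?_
    rw [← T.mk_rep, ← P.mk_rep, Projectivization.mk_eq_mk_iff']
    exact ⟨x, hxy⟩
  refine ⟨(x * a)⁻¹ * (y * b), by simp [*], ?_⟩
  convert (isCoord_rep T).smul (inv_ne_zero (mul_ne_zero hx ha)) using 1
  rw [← hxy, hva, hwb, smul_add, smul_smul, smul_smul, smul_smul, smul_smul,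
    mul_assoc _ x a, inv_mul_cancel₀ (mul_ne_zero hx ha), one_smul, mul_assoc]

theorem IsThird.symm {P Q T : Projectivization C (Fin 3 → C)} (h : IsThird P Q T) :
    IsThird Q P T :=
  ⟨h.2.1, h.1, by rw [Set.pair_comm]; exact h.2.2⟩

theorem IsThird.exchange {P Q T : Projectivization C (Fin 3 → C)} (h : IsThird P Q T)
    (hPQ : P ≠ Q) : IsThird P T Q := by
  refine ⟨hPQ.symm, h.2.1.symm, ?_⟩
  obtain ⟨c, hc, hT⟩ := h.exists_isCoord (isCoord_rep P) (isCoord_rep Q)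
  obtain ⟨k, hk, hkT⟩ := hT.exists_smul (isCoord_rep T)
  rw [Submodule.mem_span_pair]
  refine ⟨-c⁻¹, c⁻¹ * k, ?_⟩
  rw [mul_smul, ← hkT, smul_add, smul_smul, inv_mul_cancel₀ hc]
  simp

theorem linearIndependent_of_not_isThird {P Q S : Projectivization C (Fin 3 → C)}
    (hPQ : P ≠ Q) (hP : S ≠ P) (hQ : S ≠ Q) (h : ¬ IsThird P Q S) {u v w : Fin 3 → C}
    (hu : IsCoord u P) (hv : IsCoord v Q) (hw : IsCoord w S) :
    LinearIndependent C ![u, v, w] := by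
  obtain ⟨a, ha, rfl⟩ := hu.exists_smul (isCoord_rep P)
  obtain ⟨b, hb, rfl⟩ := hv.exists_smul (isCoord_rep Q)
  obtain ⟨c, hc, rfl⟩ := hw.exists_smul (isCoord_rep S)
  have hli : LinearIndependent C ![P.rep, Q.rep, S.rep] := by
    have h1 : S.rep ∉ Submodule.span C (Set.range ![P.rep, Q.rep]) := fun hS => by
      refine h ⟨hP, hQ, ?_⟩
      rwa [range_pair] at hS
    have := (linearIndependent_rep hPQ).finSnoc h1
    have hsnoc : Fin.snoc ![P.rep, Q.rep] S.rep = ![P.rep, Q.rep, S.rep] := by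
      ext i
      fin_cases i <;> rfl
    rwa [hsnoc] at this
  have := hli.units_smul ![Units.mk0 a ha, Units.mk0 b hb, Units.mk0 c hc]
  have hsmul : ![Units.mk0 a ha, Units.mk0 b hb, Units.mk0 c hc] • ![P.rep, Q.rep, S.rep] =
      ![a • P.rep, b • Q.rep, c • S.rep] := by
    ext i
    fin_cases i <;> rfl
  rwa [hsmul] at this

end ProjectivePlane

section Subunital

variable {C : Type*} [Field C] {R : Subfield C} {ε t d : C} {σ : C →+* C}

theorem IsSubunital.exists_isThird {U : Set (Projectivization C (Fin 3 → C))}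
    (hU : IsSubunital R σ ε 2 U) {P Q : Projectivization C (Fin 3 → C)} (hP : P ∈ U) (hQ : Q ∈ U)
    (hPQ : P ≠ Q) : ∃ T ∈ U, IsThird P Q T ∧ ∀ S ∈ U, IsThird P Q S → S = T := by
  obtain ⟨hsub, -, hblock⟩ := hU
  obtain ⟨f, hf, hfP, hfQ⟩ := exists_linearForm_vanishing P.rep Q.rep
  have hspan := apply_eq_zero_iff_mem_span hf (linearIndependent_rep hPQ) hfP hfQ
  have hcard := hblock _ ⟨_, ⟨f, hf, rfl⟩, ⟨P, ⟨hsub hP, hfP⟩, Q, ⟨hsub hQ, hfQ⟩, hPQ⟩, rfl⟩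
    ⟨P, ⟨⟨hsub hP, hfP⟩, hP⟩, Q, ⟨⟨hsub hQ, hfQ⟩, hQ⟩, hPQ⟩
  set B := hermSet R σ ε ∩ {P | f P.rep = 0} ∩ U with hB
  have hmem : ∀ S, S ∈ B ↔ S ∈ U ∧ S.rep ∈ Submodule.span C {P.rep, Q.rep} := fun S => by
    rw [← hspan]
    exact ⟨fun h => ⟨h.2, h.1.2⟩, fun h => ⟨⟨hsub h.1, h.2⟩, h.1⟩⟩
  have hPQB : {P, Q} ⊆ B := by
    rintro S (rfl | rfl)
    · exact ⟨⟨hsub hP, hfP⟩, hP⟩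
    · exact ⟨⟨hsub hQ, hfQ⟩, hQ⟩
  have hone : (B \ {P, Q}).ncard = 1 := by
    rw [Set.ncard_sdiff hPQB, hcard, Set.ncard_pair hPQ]
  obtain ⟨T, hT⟩ := Set.ncard_eq_one.1 hone
  have hiff : ∀ S, S ∈ U ∧ IsThird P Q S ↔ S = T := fun S => by
    rw [← Set.mem_singleton_iff (b := T), ← hT, Set.mem_sdiff, hmem, IsThird]
    simp only [Set.mem_insert_iff, Set.mem_singleton_iff, not_or]
    tauto
  obtain ⟨hTU, hT3⟩ := (hiff T).2 rfl
  exact ⟨T, hTU, hT3, fun S hS h => (hiff S).1 ⟨hS, h⟩⟩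

theorem IsSubunital.exists_mul {U : Set (Projectivization C (Fin 3 → C))}
    (hU : IsSubunital R σ ε 2 U) : ∃ m : U → U → U, (∀ P, m P P = P) ∧
      (∀ P Q, m P Q = m Q P) ∧ (∀ P Q, m P (m P Q) = Q) ∧
      ∀ P Q S : U, P ≠ Q → (IsThird P.1 Q.1 S.1 ↔ S = m P Q) := by
  classical
  have h : ∀ P Q : U, ∃ T : U, P ≠ Q → ∀ S : U, IsThird P.1 Q.1 S.1 ↔ S = T := fun P Q => by
    by_cases hPQ : P = Q
    · exact ⟨P, fun h => absurd hPQ h⟩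
    · obtain ⟨T, hT, h3, huniq⟩ := hU.exists_isThird P.2 Q.2 (Subtype.coe_injective.ne hPQ)
      exact ⟨⟨T, hT⟩, fun _ S => ⟨fun hS => Subtype.ext (huniq S S.2 hS), fun hS => hS ▸ h3⟩⟩
  choose n hn using h
  have hcomm : ∀ P Q, P ≠ Q → n P Q = n Q P := fun P Q hPQ =>
    (hn Q P hPQ.symm _).1 ((hn P Q hPQ _).2 rfl).symm
  have hinv : ∀ P Q, P ≠ Q → n P Q ≠ P ∧ n P (n P Q) = Q := fun P Q hPQ => by
    have h3 := (hn P Q hPQ _).2 rfl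
    have hne : n P Q ≠ P := fun h => h3.1 (congrArg Subtype.val h)
    exact ⟨hne, ((hn P _ hne.symm _).1 (h3.exchange (Subtype.coe_injective.ne hPQ))).symm⟩
  refine ⟨fun P Q => if P = Q then P else n P Q, by simp, fun P Q => ?_, fun P Q => ?_,
    fun P Q S hPQ => by simpa [hPQ] using hn P Q hPQ S⟩
  · by_cases hPQ : P = Q
    · simp [hPQ]
    · simpa [hPQ, Ne.symm hPQ] using hcomm P Q hPQ
  · by_cases hPQ : P = Q
    · simp [hPQ]
    · obtain ⟨h1, h2⟩ := hinv P Q hPQ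
      simp [hPQ, h1.symm, h2]

/-- Coordinates of a subunital of order `2` with respect to a suitable basis. -/
theorem IsSubunital.exists_hesse {U : Set (Projectivization C (Fin 3 → C))}
    (hU : IsSubunital R σ ε 2 U) : ∃ (e₁ e₂ e₃ : Fin 3 → C) (a b : C),
      LinearIndependent C ![e₁, e₂, e₃] ∧ a + b = 1 ∧ a * b = 1 ∧
      ∀ v ∈ [e₁, e₂, e₃, e₁ + a • e₂, e₁ + b • e₃, e₂ + e₃, e₁ + e₂ + e₃, e₁ + e₂ + b • e₃,
        e₁ + a • e₂ + e₃], ∃ P ∈ U, IsCoord v P := by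
  obtain ⟨m, idem, comm, inv, hm⟩ := hU.exists_mul
  have hcard : Nat.card U = 9 := by rw [Nat.card_coe_set_eq, hU.2.1]; norm_num
  have : Finite U := Nat.finite_of_card_ne_zero (by omega)
  have dist := steiner_distrib hcard m idem comm inv
  obtain ⟨P, -⟩ := exists_not_mem_list ([] : List U) (by simp [hcard])
  obtain ⟨Q, hQ⟩ := exists_not_mem_list [P] (by simp [hcard])
  obtain ⟨S, hS⟩ := exists_not_mem_list [P, Q, m P Q] (by simp [hcard])
  simp only [List.mem_cons, List.not_mem_nil, or_false, not_or] at hQ hS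
  have hmul : ∀ {A B T : U} {v w : Fin 3 → C}, m A B = T → A ≠ B → IsCoord v A.1 →
      IsCoord w B.1 → ∃ c : C, c ≠ 0 ∧ IsCoord (v + c • w) T.1 :=
    fun hT hAB hv hw => ((hm _ _ _ hAB).2 hT.symm).exists_isCoord hv hw
  obtain ⟨p, hp⟩ : ∃ p, m P Q = p := ⟨_, rfl⟩
  obtain ⟨q, hq⟩ : ∃ q, m Q S = q := ⟨_, rfl⟩
  obtain ⟨r, hr⟩ : ∃ r, m P S = r := ⟨_, rfl⟩
  obtain ⟨f, hf⟩ : ∃ f, m p r = f := ⟨_, rfl⟩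
  obtain ⟨g, hg⟩ : ∃ g, m Q r = g := ⟨_, rfl⟩
  obtain ⟨h, hh⟩ : ∃ h, m S p = h := ⟨_, rfl⟩
  have hf' : m q P = f := by rw [comm, ← hq, dist, hp, hr, hf]
  have hg' : m p q = g := by rw [← hg, ← hr, dist, comm Q P, hp, hq]
  have hh' : m r q = h := by rw [← hh, ← hp, dist, comm S P, hr, comm S Q, hq]
  have hSq : m S q = Q := by rw [← hq, comm Q S, inv]
  have hSP : m S P = r := by rw [comm, hr]
  have hfg : m f S = g := by rw [← hf', comm, dist, hSq, hSP, hg]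
  have hPQ : P ≠ Q := Ne.symm hQ
  have hPS : P ≠ S := Ne.symm hS.1
  have hQS : Q ≠ S := Ne.symm hS.2.1
  have hpS : p ≠ S := by grind
  have hpq : p ≠ q := by grind
  have hpr : p ≠ r := by grind
  have hqr : r ≠ q := by grind
  have hQr : r ≠ Q := by grind
  have hqP : q ≠ P := by grind
  have hfS : f ≠ S := by grind
  obtain ⟨a, ha, Cp⟩ := hmul hp hPQ (isCoord_rep _) (isCoord_rep _)
  have CP := isCoord_rep P.1
  have CQ := isCoord_rep Q.1
  have CS := isCoord_rep S.1
  set x := P.1.rep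
  set y := Q.1.rep
  obtain ⟨c, hc, Cq⟩ := hmul hq hQS CQ CS
  replace CS := CS.smul hc
  set z := c • S.1.rep
  obtain ⟨b, hb, Cr⟩ := hmul hr hPS CP CS
  have hli : LinearIndependent C ![x, y, z] :=
    linearIndependent_of_not_isThird (Subtype.coe_injective.ne hPQ)
      (Subtype.coe_injective.ne hPS.symm) (Subtype.coe_injective.ne hQS.symm)
      (fun h3 => hS.2.2 ((hm P Q S hPQ).1 h3)) CP CQ CS
  have coef : ∀ {a₁ a₂ a₃ b₁ b₂ b₃ : C},
      a₁ • x + a₂ • y + a₃ • z = b₁ • x + b₂ • y + b₃ • z → a₁ = b₁ ∧ a₂ = b₂ ∧ a₃ = b₃ := by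
    intro a₁ a₂ a₃ b₁ b₂ b₃ h
    have h0 : (a₁ - b₁) • x + (a₂ - b₂) • y + (a₃ - b₃) • z = 0 := by
      rw [← sub_eq_zero] at h
      rw [← h]
      module
    simpa only [sub_eq_zero] using eq_zero_of_combination_eq_zero hli h0
  obtain ⟨g₁, hg₁, Cg⟩ := hmul (comm r Q ▸ hg) hQr Cr CQ
  obtain ⟨g₂, hg₂, Cg'⟩ := hmul hg' hpq Cp Cq
  obtain ⟨h₁, hh₁, Ch⟩ := hmul (comm p S ▸ hh) hpS Cp CS
  obtain ⟨h₂, hh₂, Ch'⟩ := hmul hh' hqr Cr Cq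
  obtain ⟨f₁, hf₁, Cf⟩ := hmul hf hpr Cp Cr
  obtain ⟨f₂, hf₂, Cf'⟩ := hmul hf' hqP Cq CP
  obtain ⟨k, hk, eg⟩ := Cg.exists_smul Cg'
  obtain ⟨l, hl, eh⟩ := Ch.exists_smul Ch'
  obtain ⟨j, hj, ef⟩ := Cf.exists_smul Cf'
  obtain ⟨eg₁, eg₂, eg₃⟩ := coef (a₁ := 1) (a₂ := g₁) (a₃ := b) (b₁ := k) (b₂ := k * (a + g₂))
    (b₃ := k * g₂) ((Eq.trans (by module) eg).trans (by module))
  obtain ⟨eh₁, eh₂, eh₃⟩ := coef (a₁ := 1) (a₂ := a) (a₃ := h₁) (b₁ := l) (b₂ := l * h₂)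
    (b₃ := l * (b + h₂)) ((Eq.trans (by module) eh).trans (by module))
  obtain ⟨ef₁, ef₂, ef₃⟩ := coef (a₁ := 1 + f₁) (a₂ := a) (a₃ := f₁ * b) (b₁ := j * f₂)
    (b₂ := j) (b₃ := j) ((Eq.trans (by module) ef).trans (by module))
  subst eg₁ eh₁ ef₂
  obtain ⟨s, hs, Cg''⟩ := hmul hfg hfS Cf CS
  obtain ⟨i, hi, eg'⟩ := Cg''.exists_smul Cg
  obtain ⟨ei₁, ei₂, ei₃⟩ := coef (a₁ := 1 + f₁) (a₂ := a) (a₃ := f₁ * b + s) (b₁ := i)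
    (b₂ := i * g₁) (b₃ := i * b) ((Eq.trans (by module) eg').trans (by module))
  have hκ : g₁ = a + b := by linear_combination eg₂ - eg₃
  have hκ' : h₁ = a + b := by linear_combination eh₃ - eh₂
  have hκ0 : a + b ≠ 0 := hκ ▸ hg₁
  have hab : (a + b) * (a + b) = a * b := by
    linear_combination b * (a + b) * ei₁ - b * ei₂ - i * b * hκ - (a + b) * ef₃
  refine ⟨x, (a + b) • y, (a + b) • z, a / (a + b), b / (a + b), ?_, ?_, ?_, ?_⟩
  · have := hli.units_smul ![1, Units.mk0 (a + b) hκ0, Units.mk0 (a + b) hκ0]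
    have hsmul : ![1, Units.mk0 (a + b) hκ0, Units.mk0 (a + b) hκ0] • ![x, y, z] =
        ![x, (a + b) • y, (a + b) • z] := by
      ext i
      fin_cases i <;> simp
    rwa [hsmul] at this
  · field_simp
  · field_simp
    linear_combination -hab
  · have hsm : ∀ (e : C) (v : Fin 3 → C), (e / (a + b)) • (a + b) • v = e • v := fun e v => by
      rw [smul_smul, div_mul_cancel₀ _ hκ0]
    simp only [List.mem_cons, List.not_mem_nil, or_false, forall_eq_or_imp, forall_eq, hsm]
    refine ⟨⟨P, P.2, CP⟩, ⟨Q, Q.2, CQ.smul hκ0⟩, ⟨S, S.2, CS.smul hκ0⟩, ⟨p, p.2, Cp⟩,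
      ⟨r, r.2, Cr⟩, ⟨q, q.2, ?_⟩, ⟨f, f.2, ?_⟩, ⟨g, g.2, ?_⟩, ⟨h, h.2, ?_⟩⟩
    · rw [← smul_add]
      exact Cq.smul hκ0
    · convert Cf.smul (inv_ne_zero hi) using 1
      have h₂ : i * (a + b) = a := by rw [← hκ, ← ei₂]
      have hz : f₁ • b • z = a • z := by rw [smul_smul, ef₃]
      rw [eq_inv_smul_iff₀ hi, smul_add, smul_add, smul_smul i _ y, smul_smul i _ z, h₂, ← ei₁,
        smul_add f₁, hz]
      module
    · convert Cg using 1
      rw [hκ]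
      module
    · convert Ch using 1
      rw [hκ']

end Subunital

section Configuration

theorem IsSubunital.char_two_and_exists_root {C : Type*} [Field C] {R : Subfield C}
    {ε t d : C} {σ : C →+* C} (hrank : Module.finrank R C = 2) (hε : ε ∉ R) (ht : t ∈ R)
    (hd : d ∈ R) (hmin : ε ^ 2 - t * ε + d = 0) (hσR : ∀ r ∈ R, σ r = r) (hσε : σ ε = t - ε)
    {U : Set (Projectivization C (Fin 3 → C))} (hU : IsSubunital R σ ε 2 U) :
    ringChar C = 2 ∧ ∃ u : C, u ∉ R ∧ u ^ 2 + u + 1 = 0 := by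
  obtain ⟨e₁, e₂, e₃, a, b, hli, hab, hab', hpts⟩ := hU.exists_hesse
  replace hpts : ∀ v ∈ _, IsHermVec R σ ε v := fun v hv => by
    obtain ⟨P, hP, hv0, rfl⟩ := hpts v hv
    exact isHermVec_of_mem_hermSet hrank hε ht hd hmin hσR hσε hv0 (hU.1 hP)
  simp only [List.mem_cons, List.not_mem_nil, or_false, forall_eq_or_imp, forall_eq] at hpts
  obtain ⟨h₁, h₂, h₃, hp, hr, hq, hf, hg, hh⟩ := hpts
  obtain ⟨htwo, ha⟩ :=
    char_two_of_hesse hrank hε ht hd hmin hσR hσε hli hab hab' h₁ h₂ h₃ hp hr hq hf hg hh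
  have : CharP C 2 := CharTwo.of_one_ne_zero_of_two_eq_zero one_ne_zero htwo
  exact ⟨ringChar.eq C 2, a, ha, by linear_combination a * hab - hab' + a * htwo⟩

/-- The determinant of the matrix with rows `u`, `v`, `w`. -/
def det₃ {K : Type*} [CommRing K] (u v w : Fin 3 → K) : K :=
  u 0 * (v 1 * w 2 - v 2 * w 1) - u 1 * (v 0 * w 2 - v 2 * w 0) + u 2 * (v 0 * w 1 - v 1 * w 0)

theorem linearIndependent_iff_det₃_ne_zero {K : Type*} [Field K] (u v w : Fin 3 → K) :
    LinearIndependent K ![u, v, w] ↔ det₃ u v w ≠ 0 := by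
  have h : (Matrix.of ![u, v, w]).det = det₃ u v w := by
    rw [Matrix.det_fin_three]
    simp [det₃]
    ring
  rw [← h, ← isUnit_iff_ne_zero, ← Matrix.isUnit_iff_isUnit_det,
    ← Matrix.linearIndependent_rows_iff_isUnit]
  rfl

theorem linearIndependent_triple_iff {K : Type*} [Field K] (u v w : Fin 3 → K) :
    LinearIndependent K ![u, v, w] ↔
      LinearIndependent K ![u, v] ∧ w ∉ Submodule.span K {u, v} := by
  have hsnoc : Fin.snoc ![u, v] w = ![u, v, w] := by
    ext i
    fin_cases i <;> rfl
  rw [← range_pair, ← linearIndependent_finSnoc, hsnoc]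

/-- Nine points of `H(C|R)` form a subunital if the line joining any two of them contains exactly
three of them. -/
theorem isSubunital_range {C : Type*} [Field C] {R : Subfield C} {ε : C} {σ : C →+* C}
    {p : Fin 9 → Fin 3 → C} {P : Fin 9 → Projectivization C (Fin 3 → C)}
    (hp : ∀ i, IsCoord (p i) (P i)) (hP : ∀ i, P i ∈ hermSet R σ ε)
    (h3 : ∀ i j, i ≠ j → {k | det₃ (p i) (p j) (p k) = 0}.ncard = 3) :
    IsSubunital R σ ε 2 (Set.range P) := by
  have hli : ∀ i j, i ≠ j → LinearIndependent C ![p i, p j] := fun i j hij => by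
    obtain ⟨k, hk⟩ : ∃ k, det₃ (p i) (p j) (p k) ≠ 0 := by
      by_contra! h
      have := h3 i j hij
      simp [h, Set.ncard_univ] at this
    exact ((linearIndependent_triple_iff _ _ _).1
      ((linearIndependent_iff_det₃_ne_zero _ _ _).2 hk)).1
  have hinj : Function.Injective P := fun i j hij => by
    by_contra hne
    obtain ⟨c, -, hc⟩ := (hp i).exists_smul (hij ▸ hp j)
    have := LinearIndependent.pair_iff.1 (hli i j hne) 1 (-c) (by rw [hc]; module)
    simp at this
  refine ⟨Set.range_subset_iff.2 hP, ?_, ?_⟩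
  · rw [← Set.image_univ, Set.ncard_image_of_injective _ hinj, Set.ncard_univ]
    simp
  · rintro _ ⟨_, ⟨f, hf, rfl⟩, -, rfl⟩ ⟨_, ⟨⟨-, hfi⟩, i, rfl⟩, _, ⟨⟨-, hfj⟩, j, rfl⟩, hij⟩
    have hrep : ∀ k, f (P k).rep = 0 ↔ f (p k) = 0 := fun k => by
      obtain ⟨c, hc, h⟩ := (isCoord_rep (P k)).exists_smul (hp k)
      simp [h, hc]
    have hne : i ≠ j := fun h => hij (congrArg P h)
    have hzero : ∀ k, f (p k) = 0 ↔ det₃ (p i) (p j) (p k) = 0 := fun k => by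
      rw [apply_eq_zero_iff_mem_span hf (hli i j hne) ((hrep i).1 hfi) ((hrep j).1 hfj),
        ← not_iff_not, ← ne_eq (det₃ _ _ _), ← linearIndependent_iff_det₃_ne_zero,
        linearIndependent_triple_iff]
      simp [hli i j hne]
    have hset : hermSet R σ ε ∩ {P | f P.rep = 0} ∩ Set.range P =
        P '' {k | det₃ (p i) (p j) (p k) = 0} := by
      ext T
      constructor
      · rintro ⟨⟨-, hT⟩, k, rfl⟩
        exact ⟨k, (hzero k).1 ((hrep k).1 hT), rfl⟩
      · rintro ⟨k, hk, rfl⟩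
        exact ⟨⟨hP k, (hrep k).2 ((hzero k).2 hk)⟩, k, rfl⟩
    rw [hset, Set.ncard_image_of_injective _ hinj, h3 i j hne]

/-- Nine points of the projective plane over the field with four elements which form an affine
plane of order `3`. -/
def hessePoint : Fin 9 → Fin 3 → QuadraticAlgebra (ZMod 2) 1 1 :=
  ![![0, 1, 0], ![1, 0, 0], ![1, 1, 0], ![1, ⟨1, 1⟩, 1], ![1, ⟨1, 1⟩, ⟨0, 1⟩],
    ![1, ⟨1, 1⟩, ⟨1, 1⟩], ![1, ⟨0, 1⟩, 1], ![1, ⟨0, 1⟩, ⟨0, 1⟩], ![1, ⟨0, 1⟩, ⟨1, 1⟩]]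

theorem det₃_hessePoint : ∀ i j k, det₃ (hessePoint i) (hessePoint j) (hessePoint k) = 0 ∨
    det₃ (hessePoint i) (hessePoint j) (hessePoint k) ^ 3 = 1 := by
  decide +kernel

theorem card_hessePoint_collinear : ∀ i j, i ≠ j → (Finset.univ.filter fun k =>
    det₃ (hessePoint i) (hessePoint j) (hessePoint k) = 0).card = 3 := by
  decide +kernel

/-- The image of `hessePoint` under a ring homomorphism and a scaling of the second coordinate. -/
def scaledHessePoint {C : Type*} [Field C] (φ : QuadraticAlgebra (ZMod 2) 1 1 →+* C) (s : C)
    (i : Fin 9) : Fin 3 → C :=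
  ![φ (hessePoint i 0), s * φ (hessePoint i 1), φ (hessePoint i 2)]

theorem ncard_scaledHessePoint_collinear {C : Type*} [Field C]
    (φ : QuadraticAlgebra (ZMod 2) 1 1 →+* C) {s : C} (hs : s ≠ 0) (i j : Fin 9) (hij : i ≠ j) :
    {k | det₃ (scaledHessePoint φ s i) (scaledHessePoint φ s j)
      (scaledHessePoint φ s k) = 0}.ncard = 3 := by
  rw [← card_hessePoint_collinear i j hij, ← Set.ncard_coe_finset]
  congr 1
  ext k
  have h : det₃ (scaledHessePoint φ s i) (scaledHessePoint φ s j) (scaledHessePoint φ s k) =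
      s * φ (det₃ (hessePoint i) (hessePoint j) (hessePoint k)) := by
    simp [det₃, scaledHessePoint]
    ring
  simp only [Set.mem_ofPred_eq, Finset.coe_filter, Finset.mem_univ, true_and, h, mul_eq_zero, hs,
    false_or]
  refine ⟨fun h0 => (det₃_hessePoint i j k).resolve_right fun h1 => ?_, fun h0 => by simp [h0]⟩
  have h2 := congrArg φ h1
  simp [h0] at h2

theorem exists_isSubunital {C : Type*} [Field C] {R : Subfield C}
    {ε t d : C} {σ : C →+* C} (hrank : Module.finrank R C = 2) (hε : ε ∉ R) (ht : t ∈ R)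
    (hd : d ∈ R) (hmin : ε ^ 2 - t * ε + d = 0) (hσR : ∀ r ∈ R, σ r = r) (hσε : σ ε = t - ε)
    (hchar : ringChar C = 2) {u : C} (hu : u ∉ R) (hroot : u ^ 2 + u + 1 = 0) :
    ∃ U, IsSubunital R σ ε 2 U := by
  have : CharP C 2 := ringChar.of_eq hchar
  have htwo : (2 : C) = 0 := CharTwo.two_eq_zero
  have hε0 : ε ≠ 0 := fun h => hε (h ▸ R.zero_mem)
  have hσu : σ u = u + 1 := by
    have h1 := congrArg σ hroot
    simp only [map_add, map_pow, map_one, map_zero] at h1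
    have h2 : (σ u - u) * (σ u - (u + 1)) = 0 := by
      linear_combination h1 + hroot - (u * σ u + σ u + 1) * htwo
    refine sub_eq_zero.1 ((mul_eq_zero.1 h2).resolve_left fun h => hu ?_)
    have h3 := conj_mul_mem hrank hε ht hd hmin hσR hσε u
    rw [sub_eq_zero.1 h] at h3
    rw [show u = -(u * u + 1) by linear_combination hroot]
    exact R.neg_mem (R.add_mem h3 R.one_mem)
  obtain ⟨x, hx, y, hy, hxy⟩ := exists_eq_add_mul hrank hu ε⁻¹
  have hone : ε * (x + y * u) = 1 := by rw [← hxy, mul_inv_cancel₀ hε0]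
  have hy0 : y ≠ 0 := by
    rintro rfl
    refine hε ?_
    rw [← inv_inv ε, hxy, zero_mul, add_zero]
    exact R.inv_mem hx
  let _ : Algebra (ZMod 2) C := ZMod.algebra C 2
  let φ : QuadraticAlgebra (ZMod 2) 1 1 →+* C := (QuadraticAlgebra.lift
    ⟨u, by rw [one_smul, one_smul]; linear_combination hroot - (u + 1) * htwo⟩ :
      QuadraticAlgebra (ZMod 2) 1 1 →ₐ[ZMod 2] C)
  have hφu : φ ⟨0, 1⟩ = u := by simp [φ, QuadraticAlgebra.lift]
  have hφu' : φ ⟨1, 1⟩ = 1 + u := by simp [φ, QuadraticAlgebra.lift]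
  have hs : ε * y ≠ 0 := mul_ne_zero hε0 hy0
  have hv : ∀ i, scaledHessePoint φ (ε * y) i ≠ 0 := fun i h => by
    have h0 := congrFun h 0
    have h1 := congrFun h 1
    fin_cases i <;> simp [scaledHessePoint, hessePoint, hε0, hy0] at h0 h1
  refine ⟨_, isSubunital_range (p := scaledHessePoint φ (ε * y))
    (P := fun i => Projectivization.mk C _ (hv i)) (fun i => ⟨hv i, rfl⟩) (fun i => ?_)
    (ncard_scaledHessePoint_collinear φ hs)⟩
  refine ⟨_, hv i, rfl, ?_⟩
  fin_cases i <;> simp [scaledHessePoint, hessePoint, hφu, hφu', hσu]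
  · exact ⟨0, R.zero_mem, .inr rfl⟩
  · exact ⟨0, R.zero_mem, .inr rfl⟩
  · exact ⟨y, hy, .inl rfl⟩
  · exact ⟨x + y, R.add_mem hx hy, by linear_combination hone + (1 - ε * x) * htwo⟩
  · exact ⟨x + y, R.add_mem hx hy, by linear_combination hone + hroot - ε * x * htwo⟩
  · exact ⟨x + y, R.add_mem hx hy, by linear_combination hone + hroot + (1 + u - ε * x) * htwo⟩
  · exact ⟨x, hx, by linear_combination hone + (1 - ε * x) * htwo⟩
  · exact ⟨x, hx, by linear_combination hone + hroot - ε * x * htwo⟩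
  · exact ⟨x, hx, by linear_combination hone + hroot + (1 + u - ε * x) * htwo⟩

end Configuration

/-- `H(C|R)` contains a subunital of order `2` if and only if `R` (equivalently `C`)
has characteristic `2` and `C` contains a root of `X² + X + 1` outside `R`. -/
theorem subunital_order_two_iff
    {C : Type*} [Field C] (R : Subfield C) (ε t d : C) (σ : C →+* C)
    (hrank : Module.finrank R C = 2)
    (hε : ε ∉ R) (ht : t ∈ R) (hd : d ∈ R)
    (hmin : ε ^ 2 - t * ε + d = 0)
    (hσR : ∀ r ∈ R, σ r = r) (hσε : σ ε = t - ε) :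
    (∃ U, IsSubunital R σ ε 2 U) ↔
      (ringChar C = 2 ∧ ∃ u : C, u ∉ R ∧ u ^ 2 + u + 1 = 0) := by
  constructor
  · rintro ⟨U, hU⟩
    exact hU.char_two_and_exists_root hrank hε ht hd hmin hσR hσε
  · rintro ⟨hchar, u, hu, hroot⟩
    exact exists_isSubunital hrank hε ht hd hmin hσR hσε hchar hu hroot
end
end

section
/- If C|R is an inseparable quadratic field extension (i.e. σ = id), then the generalized hermitian unital H(C|R) contains no subunital of order 2. -/
noncomputable section

open Matrix

/-- The quadratic form `XY + Z²`. -/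
def unitalForm {C : Type*} [Field C] (v : Fin 3 → C) : C := v 0 * v 1 + v 2 * v 2

/-- The polar form of `XY + Z²`. -/
def unitalPolar {C : Type*} [Field C] (v w : Fin 3 → C) : C :=
  v 0 * w 1 + v 1 * w 0 + 2 * (v 2 * w 2)

theorem unitalForm_smul {C : Type*} [Field C] (c : C) (v : Fin 3 → C) :
    unitalForm (c • v) = c ^ 2 * unitalForm v := by
  simp [unitalForm]; ring

theorem unitalForm_smul_add_smul {C : Type*} [Field C] (p q : C) (v w : Fin 3 → C) :
    unitalForm (p • v + q • w) =
      p ^ 2 * unitalForm v + q ^ 2 * unitalForm w + p * q * unitalPolar v w := by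
  simp [unitalForm, unitalPolar]; ring

theorem det_sq_eq_unitalForm {C : Type*} [Field C] (u v w : Fin 3 → C) :
    (Matrix.of ![u, v, w]).det ^ 2 =
      unitalForm u * unitalPolar v w ^ 2 + unitalForm v * unitalPolar u w ^ 2 +
      unitalForm w * unitalPolar u v ^ 2 - unitalPolar v w * unitalPolar u w * unitalPolar u v -
      4 * (unitalForm u * unitalForm v * unitalForm w) := by
  simp [unitalForm, unitalPolar, Matrix.det_fin_three]; ring

section

variable {C : Type*} [Field C] {R : Subfield C} {ε : C}

theorem unitalPolar_div_mem (hsq : ∀ c : C, c ^ 2 ∈ R) {p q : C} {v w : Fin 3 → C} (hp : p ≠ 0)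
    (hq : q ≠ 0) (hpq : q / p ∈ R) (hv : unitalForm v / ε ∈ R) (hw : unitalForm w / ε ∈ R)
    (h : unitalForm (p • v + q • w) / ε ∈ R) : unitalPolar v w / ε ∈ R := by
  have key : unitalPolar v w / ε = (unitalForm (p • v + q • w) / ε - p ^ 2 * (unitalForm v / ε) -
      q ^ 2 * (unitalForm w / ε)) / (p ^ 2 * (q / p)) := by
    rw [unitalForm_smul_add_smul]
    field_simp
    ring
  rw [key]
  exact R.div_mem (R.sub_mem (R.sub_mem h (R.mul_mem (hsq p) hv)) (R.mul_mem (hsq q) hw))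
    (R.mul_mem (hsq p) hpq)

theorem det_eq_zero_of_unitalPolar_div_mem (hsq : ∀ c : C, c ^ 2 ∈ R) (hε : ε ∉ R)
    {u v w : Fin 3 → C} (hu : unitalForm u / ε ∈ R) (hv : unitalForm v / ε ∈ R)
    (hw : unitalForm w / ε ∈ R) (huv : unitalPolar u v / ε ∈ R) (huw : unitalPolar u w / ε ∈ R)
    (hvw : unitalPolar v w / ε ∈ R) : (Matrix.of ![u, v, w]).det = 0 := by
  have hε0 : ε ≠ 0 := fun h => hε (h ▸ R.zero_mem)
  by_contra hdet
  have key : (Matrix.of ![u, v, w]).det ^ 2 / ε =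
      unitalForm u / ε * unitalPolar v w ^ 2 + unitalForm v / ε * unitalPolar u w ^ 2 +
      unitalForm w / ε * unitalPolar u v ^ 2 -
      ε ^ 2 * (unitalPolar v w / ε * (unitalPolar u w / ε) * (unitalPolar u v / ε)) -
      2 ^ 2 * ε ^ 2 * (unitalForm u / ε * (unitalForm v / ε) * (unitalForm w / ε)) := by
    rw [det_sq_eq_unitalForm]
    field_simp
    ring
  have hmem : (Matrix.of ![u, v, w]).det ^ 2 / ε ∈ R := by
    rw [key]
    exact R.sub_mem (R.sub_mem (R.add_mem (R.add_mem (R.mul_mem hu (hsq _)) (R.mul_mem hv (hsq _)))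
      (R.mul_mem hw (hsq _))) (R.mul_mem (hsq _) (R.mul_mem (R.mul_mem hvw huw) huv)))
      (R.mul_mem (R.mul_mem (hsq _) (hsq _)) (R.mul_mem (R.mul_mem hu hv) hw))
  refine hε ?_
  have := R.div_mem (hsq (Matrix.of ![u, v, w]).det) hmem
  rwa [div_div_cancel₀ (pow_ne_zero 2 hdet)] at this

theorem eq_zero_of_det_ne_zero {u v w : Fin 3 → C} (h : (Matrix.of ![u, v, w]).det ≠ 0)
    {x y z : C} (hxyz : x • u + y • v + z • w = 0) : x = 0 ∧ y = 0 ∧ z = 0 := by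
  have h0 : ![x, y, z] = 0 := by
    refine Matrix.eq_zero_of_vecMul_eq_zero h ?_
    ext i
    simpa [Matrix.vecMul, dotProduct, Fin.sum_univ_three] using congrFun hxyz i
  exact ⟨congrFun h0 0, congrFun h0 1, congrFun h0 2⟩

theorem coeff_ratio_of_affinePlane [CharP C 2] {u v w d e f g h : Fin 3 → C}
    (hdet : (Matrix.of ![u, v, w]).det ≠ 0)
    {e₁ e₂ f₁ f₂ g₁ g₂ g₃ g₄ h₁ h₂ h₃ h₄ s t x y : C} (hd : d = u + v + w)
    (he : e = e₁ • u + e₂ • v) (hf : f = f₁ • u + f₂ • w)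
    (hg : g = g₁ • w + g₂ • e) (hg' : g = g₃ • v + g₄ • d)
    (hh : h = h₁ • v + h₂ • f) (hh' : h = h₃ • w + h₄ • d) (hag : h = s • u + t • g)
    (hde : f = x • d + y • e)
    (he₁ : e₁ ≠ 0) (hf₁ : f₁ ≠ 0) (hg₄ : g₄ ≠ 0) (hh₄ : h₄ ≠ 0) :
    (e₂ / e₁) ^ 2 + e₂ / e₁ = 1 ∧ f₂ / f₁ = e₂ / e₁ + 1 := by
  have h2 : (2 : C) = 0 := CharTwo.two_eq_zero
  obtain ⟨G1, G2, G3⟩ := eq_zero_of_det_ne_zero (x := g₂ * e₁ - g₄) (y := g₂ * e₂ - (g₃ + g₄))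
    (z := g₁ - g₄) hdet (by
      have := hg.symm.trans hg'
      rw [he, hd, ← sub_eq_zero] at this
      rw [← this]
      module)
  obtain ⟨H1, H2, H3⟩ := eq_zero_of_det_ne_zero (x := h₂ * f₁ - h₄) (y := h₁ - h₄)
    (z := h₂ * f₂ - (h₃ + h₄)) hdet (by
      have := hh.symm.trans hh'
      rw [hf, hd, ← sub_eq_zero] at this
      rw [← this]
      module)
  obtain ⟨-, J2, J3⟩ := eq_zero_of_det_ne_zero (x := h₄ - (s + t * g₄)) (y := h₄ - t * (g₃ + g₄))
    (z := h₃ + h₄ - t * g₄) hdet (by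
      have := hh'.symm.trans hag
      rw [hg', hd, ← sub_eq_zero] at this
      rw [← this]
      module)
  obtain ⟨K1, K2, K3⟩ := eq_zero_of_det_ne_zero (x := f₁ - (x + y * e₁)) (y := - (x + y * e₂))
    (z := f₂ - x) hdet (by
      have := hf.symm.trans hde
      rw [he, hd, ← sub_eq_zero] at this
      rw [← this]
      module)
  rw [sub_eq_zero] at G1 G2 G3 H1 H2 H3 J2 J3 K1 K3
  have hl : e₂ / e₁ = (g₃ + g₄) / g₄ := by
    rw [div_eq_div_iff he₁ hg₄, ← G2, ← G1]; ring
  have hm : f₂ / f₁ = (h₃ + h₄) / h₄ := by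
    rw [div_eq_div_iff hf₁ hh₄, ← H3, ← H1]; ring
  have hlm : e₂ / e₁ * (f₂ / f₁) = 1 := by
    have ht : t ≠ 0 := by
      rintro rfl
      exact hh₄ (by simpa using J2)
    have hg34 : g₃ + g₄ ≠ 0 := fun h => hh₄ (by rw [J2, h, mul_zero])
    rw [hl, hm, J3, J2]
    field_simp
  have hx : e₂ / e₁ * e₁ = e₂ := div_mul_cancel₀ _ he₁
  have hy : f₂ / f₁ * f₁ = f₂ := div_mul_cancel₀ _ hf₁
  have hml : f₂ / f₁ = e₂ / e₁ + 1 := by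
    generalize e₂ / e₁ = l at *
    generalize f₂ / f₁ = m at *
    have hy0 : y ≠ 0 := by
      rintro rfl
      have : f₁ = 0 := by grind
      exact hf₁ this
    have : m * (1 + l) = l := mul_left_cancel₀ (mul_ne_zero hy0 he₁) (by grind)
    grind
  refine ⟨?_, hml⟩
  rw [hml] at hlm
  linear_combination hlm

end

theorem affinePlane_incidences {α : Type*} {m : α → α → α} (idem : ∀ x, m x x = x)
    (comm : ∀ x y, m x y = m y x) (inv : ∀ x y, m x (m x y) = y) {a b c d e f g h k : α}
    (hnodup : [a, b, c, d, e, f, g, h, k].Nodup) (cover : ∀ x, x ∈ [a, b, c, d, e, f, g, h, k])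
    (he : m a b = e) (hf : m a c = f) (hk : m b c = k) (hd : m a k = d) (hh : m a g = h)
    (hbf : m b f = h) :
    m c e = g ∧ m b d = g ∧ m c d = h ∧ m d e = f := by
  simp only [List.mem_cons, List.not_mem_nil, or_false] at cover
  simp only [List.nodup_cons, List.mem_cons, List.not_mem_nil, or_false, not_or] at hnodup
  have hbd : m b d = g := by
    have := cover (m b d)
    grind (splits := 20)
  have hce : m c e = d ∨ m c e = g ∨ m c e = h := by
    have := cover (m c e)
    grind (splits := 20)
  have hceg : m c e = g := by
    have := cover (m c d)
    have := cover (m c g)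
    grind (splits := 20)
  have hcd : m c d = h := by
    have := cover (m c d)
    grind (splits := 20)
  have hde : m d e = f := by
    have := cover (m d e)
    grind (splits := 20)
  exact ⟨hceg, hbd, hcd, hde⟩

theorem exists_affinePlane_labelling {α : Type*} [Fintype α] (hcard : Fintype.card α = 9)
    (m : α → α → α) (idem : ∀ x, m x x = x) (comm : ∀ x y, m x y = m y x)
    (inv : ∀ x y, m x (m x y) = y) :
    ∃ a b c d e f g h k : α, [a, b, c, d, e, f, g, h, k].Nodup ∧
      m a b = e ∧ m a c = f ∧ m b c = k ∧ m a k = d ∧ m c e = g ∧ m b d = g ∧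
      m b f = h ∧ m c d = h ∧ m a g = h ∧ m d e = f := by
  classical
  have exists_notMem (s : Finset α) (hs : s.card < 9) : ∃ x, x ∉ s := by
    by_contra! hx
    rw [Finset.eq_univ_iff_forall.2 hx, Finset.card_univ, hcard] at hs
    exact lt_irrefl _ hs
  obtain ⟨a, -⟩ := exists_notMem ∅ (by simp)
  obtain ⟨b, hb⟩ := exists_notMem {a} (by simp)
  obtain ⟨e, he⟩ : ∃ e, m a b = e := ⟨_, rfl⟩
  obtain ⟨c, hc⟩ := exists_notMem {a, b, e} (Finset.card_le_three.trans_lt (by norm_num))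
  obtain ⟨f, hf⟩ : ∃ f, m a c = f := ⟨_, rfl⟩
  obtain ⟨k, hk⟩ : ∃ k, m b c = k := ⟨_, rfl⟩
  obtain ⟨d, hd⟩ : ∃ d, m a k = d := ⟨_, rfl⟩
  obtain ⟨g, hg⟩ := exists_notMem {a, b, c, e, f, k, d}
    ((Finset.card_insert_le _ _).trans_lt (by
      have := Finset.card_le_six (a := b) (b := c) (c := e) (d := f) (e := k) (f := d)
      omega))
  obtain ⟨h, hh⟩ : ∃ h, m a g = h := ⟨_, rfl⟩
  simp only [Finset.mem_insert, Finset.mem_singleton, not_or] at hb hc hg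
  clear exists_notMem
  have he1 : e ≠ a ∧ e ≠ b := by grind
  have hf1 : f ≠ a ∧ f ≠ c ∧ f ≠ b ∧ f ≠ e := by grind
  have hk1 : k ≠ a ∧ k ≠ b ∧ k ≠ c ∧ k ≠ e ∧ k ≠ f := by grind
  have hd1 : d ≠ a ∧ d ≠ b ∧ d ≠ c ∧ d ≠ e ∧ d ≠ f ∧ d ≠ k := by grind
  have hh1 : h ≠ a ∧ h ≠ b ∧ h ≠ c ∧ h ≠ e ∧ h ≠ f ∧ h ≠ k ∧ h ≠ d ∧ h ≠ g := by grind
  have hgh : m a h = g := by rw [← hh, inv]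
  have hnodup : [a, b, c, d, e, f, g, h, k].Nodup := by
    simp only [List.nodup_cons, List.mem_cons, List.not_mem_nil, or_false, not_or,
      not_false_eq_true, List.nodup_nil, and_true]
    clear idem comm inv
    grind
  have cover (x : α) : x ∈ [a, b, c, d, e, f, g, h, k] := by
    have huniv : [a, b, c, d, e, f, g, h, k].toFinset = Finset.univ := by
      apply Finset.eq_univ_of_card
      rw [hcard, List.toFinset_card_of_nodup hnodup]
      rfl
    rw [← List.mem_toFinset, huniv]
    exact Finset.mem_univ x
  have hbf : m b f = d ∨ m b f = g ∨ m b f = h := by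
    have := cover (m b f)
    simp only [List.mem_cons, List.not_mem_nil, or_false] at this
    grind (splits := 20)
  have hbf' : m b f = g ∨ m b f = h := by
    have := cover (m b g)
    simp only [List.mem_cons, List.not_mem_nil, or_false] at this
    grind (splits := 20)
  rcases hbf' with hbg | hbh
  · have hperm : [a, b, c, d, e, f, g, h, k].Perm [a, b, c, d, e, f, h, g, k] := by
      simpa using List.Perm.swap h g [k]
    have hnodup' := hperm.nodup_iff.1 hnodup
    obtain ⟨h1, h2, h3, h4⟩ := affinePlane_incidences idem comm inv hnodup'
      (fun x => hperm.mem_iff.1 (cover x)) he hf hk hd hgh hbg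
    exact ⟨a, b, c, d, e, f, h, g, k, hnodup', he, hf, hk, hd, h1, h2, hbg, h3, hgh, h4⟩
  · obtain ⟨h1, h2, h3, h4⟩ := affinePlane_incidences idem comm inv hnodup cover he hf hk hd hh hbh
    exact ⟨a, b, c, d, e, f, g, h, k, hnodup, he, hf, hk, hd, h1, h2, hbh, h3, hh, h4⟩

section

variable {C : Type*} [Field C]

theorem Projectivization.linearIndependent_rep_pair {V : Type*} [AddCommGroup V] [Module C V]
    {x y : Projectivization C V} (h : x ≠ y) : LinearIndependent C ![x.rep, y.rep] := by
  have := Projectivization.independent_iff.1 ((Projectivization.independent_pair_iff_ne x y).2 h)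
  convert this using 1
  ext i
  fin_cases i <;> rfl

theorem exists_eq_smul_add_smul_of_det_eq_zero {x y z : Projectivization C (Fin 3 → C)}
    (hxy : x ≠ y) (hxz : x ≠ z) (hyz : y ≠ z)
    (h : (Matrix.of ![x.rep, y.rep, z.rep]).det = 0) :
    ∃ p q : C, p ≠ 0 ∧ q ≠ 0 ∧ z.rep = p • x.rep + q • y.rep := by
  have ixy := LinearIndependent.pair_iff.1 (Projectivization.linearIndependent_rep_pair hxy)
  have ixz := LinearIndependent.pair_iff.1 (Projectivization.linearIndependent_rep_pair hxz)
  have iyz := LinearIndependent.pair_iff.1 (Projectivization.linearIndependent_rep_pair hyz)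
  obtain ⟨v, hv, hv0⟩ := Matrix.exists_vecMul_eq_zero_iff.2 h
  have hsum : v 0 • x.rep + v 1 • y.rep + v 2 • z.rep = 0 := by
    ext i
    simpa [Matrix.vecMul, dotProduct, Fin.sum_univ_three] using congrFun hv0 i
  have hne (h0 : v 0 = 0) (h1 : v 1 = 0) (h2 : v 2 = 0) : False :=
    hv (by ext i; fin_cases i <;> assumption)
  have h2 : v 2 ≠ 0 := fun h2 => by
    rw [h2, zero_smul, add_zero] at hsum
    exact hne (ixy _ _ hsum).1 (ixy _ _ hsum).2 h2
  have h1 : v 1 ≠ 0 := fun h1 => by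
    rw [h1, zero_smul, add_zero] at hsum
    exact h2 (ixz _ _ hsum).2
  have h0 : v 0 ≠ 0 := fun h0 => by
    rw [h0, zero_smul, zero_add] at hsum
    exact h2 (iyz _ _ hsum).2
  refine ⟨-(v 0 / v 2), -(v 1 / v 2), neg_ne_zero.2 (div_ne_zero h0 h2),
    neg_ne_zero.2 (div_ne_zero h1 h2), ?_⟩
  ext i
  have := congrFun hsum i
  simp only [Pi.add_apply, Pi.smul_apply, smul_eq_mul, Pi.zero_apply] at this ⊢
  field_simp
  linear_combination this

theorem isLine_det {x y : Projectivization C (Fin 3 → C)} (hxy : x ≠ y) :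
    IsLine C {z | (Matrix.of ![x.rep, y.rep, z.rep]).det = 0} := by
  refine ⟨dotProductEquiv C (Fin 3) (x.rep ⨯₃ y.rep), ?_, ?_⟩
  · rw [Ne, LinearEquiv.map_eq_zero_iff]
    exact crossProduct_ne_zero_iff_linearIndependent.2
      (Projectivization.linearIndependent_rep_pair hxy)
  · ext z
    have : (Matrix.of ![x.rep, y.rep, z.rep]).det = x.rep ⨯₃ y.rep ⬝ᵥ z.rep := by
      simp [Matrix.det_fin_three, cross_apply, dotProduct, Fin.sum_univ_three]
      ring
    simp [this]

theorem unitalForm_rep_div_mem {R : Subfield C} {ε : C} (hε : ε ≠ 0) (hsq : ∀ c : C, c ^ 2 ∈ R)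
    {x : Projectivization C (Fin 3 → C)} (hx : x ∈ hermSet R (RingHom.id C) ε) :
    unitalForm x.rep / ε ∈ R := by
  obtain ⟨v, hv, rfl, r, hr, hvr⟩ := hx
  obtain ⟨a, ha⟩ := Projectivization.exists_smul_eq_mk_rep C v hv
  rw [← ha, Units.smul_def, unitalForm_smul, show unitalForm v = ε * r from hvr, mul_left_comm,
    mul_div_cancel_left₀ _ hε]
  exact R.mul_mem (hsq _) hr

theorem IsSubunital.exists_third_point {R : Subfield C} {σ : C →+* C} {ε : C}
    {U : Set (Projectivization C (Fin 3 → C))} (hU : IsSubunital R σ ε 2 U) (x y : U)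
    (hxy : x ≠ y) : ∃ z : U, z ≠ x ∧ z ≠ y ∧ ∀ w : U,
      (Matrix.of ![x.1.rep, y.1.rep, w.1.rep]).det = 0 ↔ w = x ∨ w = y ∨ w = z := by
  obtain ⟨hsub, -, hblock⟩ := hU
  have hxy' : x.1 ≠ y.1 := fun h => hxy (Subtype.ext h)
  let ℓ : Set (Projectivization C (Fin 3 → C)) :=
    {z | (Matrix.of ![x.1.rep, y.1.rep, z.rep]).det = 0}
  have hx : x.1 ∈ ℓ := Matrix.det_zero_of_row_eq (i := 0) (j := 2) (by decide) rfl
  have hy : y.1 ∈ ℓ := Matrix.det_zero_of_row_eq (i := 1) (j := 2) (by decide) rfl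
  have hcard : (hermSet R σ ε ∩ ℓ ∩ U).ncard = 3 :=
    hblock _ ⟨ℓ, isLine_det hxy', ⟨x, ⟨hsub x.2, hx⟩, y, ⟨hsub y.2, hy⟩, hxy'⟩, rfl⟩
      ⟨x, ⟨⟨hsub x.2, hx⟩, x.2⟩, y, ⟨⟨hsub y.2, hy⟩, y.2⟩, hxy'⟩
  obtain ⟨p, q, r, hpq, hpr, hqr, heq⟩ := Set.ncard_eq_three.1 hcard
  have hmem (w : Projectivization C (Fin 3 → C)) (hw : w ∈ U) : w ∈ ℓ ↔ w = p ∨ w = q ∨ w = r := by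
    have := Set.ext_iff.1 heq w
    simp only [Set.mem_inter_iff, hw, hsub hw, true_and, and_true, Set.mem_insert_iff,
      Set.mem_singleton_iff] at this
    exact this
  have hpqr (w) (hw : w = p ∨ w = q ∨ w = r) : w ∈ U := by
    have : w ∈ hermSet R σ ε ∩ ℓ ∩ U := heq ▸ hw
    exact this.2
  have hx' := (hmem x x.2).1 hx
  have hy' := (hmem y y.2).1 hy
  obtain ⟨z, hz, hzx, hzy⟩ : ∃ z, (z = p ∨ z = q ∨ z = r) ∧ z ≠ x.1 ∧ z ≠ y.1 := by
    by_contra! hcon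
    have h1 := hcon p
    have h2 := hcon q
    have h3 := hcon r
    grind
  refine ⟨⟨z, hpqr z hz⟩, fun h => hzx (congrArg Subtype.val h),
    fun h => hzy (congrArg Subtype.val h), fun w => (hmem w w.2).trans ?_⟩
  simp only [Subtype.ext_iff]
  grind

theorem IsSubunital.exists_mul_s11 {R : Subfield C} {σ : C →+* C} {ε : C}
    {U : Set (Projectivization C (Fin 3 → C))} (hU : IsSubunital R σ ε 2 U) :
    ∃ m : U → U → U, (∀ x, m x x = x) ∧ (∀ x y, m x y = m y x) ∧ (∀ x y, m x (m x y) = y) ∧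
      ∀ x y, x ≠ y → ∀ w : U,
        (Matrix.of ![x.1.rep, y.1.rep, w.1.rep]).det = 0 ↔ w = x ∨ w = y ∨ w = m x y := by
  classical
  choose t ht₁ ht₂ ht using hU.exists_third_point
  have det_swap (u v w : Fin 3 → C) :
      (Matrix.of ![u, v, w]).det = 0 ↔ (Matrix.of ![v, u, w]).det = 0 := by
    rw [← neg_eq_zero]
    simp only [Matrix.det_fin_three]
    simp
    ring_nf
  have det_swap' (u v w : Fin 3 → C) :
      (Matrix.of ![u, v, w]).det = 0 ↔ (Matrix.of ![u, w, v]).det = 0 := by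
    rw [← neg_eq_zero]
    simp only [Matrix.det_fin_three]
    simp
    ring_nf
  refine ⟨fun x y => if h : x = y then x else t x y h, fun x => by simp, fun x y => ?_,
    fun x y => ?_, fun x y hxy w => by simpa only [dif_neg hxy] using ht x y hxy w⟩
  · rcases eq_or_ne x y with rfl | hxy
    · rfl
    · simp only [dif_neg hxy, dif_neg hxy.symm]
      have := (ht y x hxy.symm (t x y hxy)).1
        ((det_swap _ _ _).1 ((ht x y hxy _).2 (Or.inr (Or.inr rfl))))
      exact (this.resolve_left (ht₂ x y hxy)).resolve_left (ht₁ x y hxy)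
  · rcases eq_or_ne x y with rfl | hxy
    · simp
    · simp only [dif_neg hxy, dif_neg (ht₁ x y hxy).symm]
      have := (ht x (t x y hxy) (ht₁ x y hxy).symm y).1
        ((det_swap' _ _ _).1 ((ht x y hxy _).2 (Or.inr (Or.inr rfl))))
      exact ((this.resolve_left hxy.symm).resolve_left (ht₂ x y hxy).symm).symm

theorem sq_mem_of_finrank_eq_two [CharP C 2] {R : Subfield C} {ε : C}
    (hrank : Module.finrank R C = 2) (hε : ε ∉ R) (hε2 : ε ^ 2 ∈ R) (c : C) : c ^ 2 ∈ R := by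
  have hli : LinearIndependent R ![1, ε] := by
    rw [LinearIndependent.pair_iff]
    intro s t hst
    simp only [Subfield.smul_def, smul_eq_mul, mul_one] at hst
    have ht : t = 0 := by
      by_contra ht
      have ht' : (t : C) ≠ 0 := fun h => ht (Subtype.ext h)
      refine hε ?_
      have : ε = -s / t := by
        field_simp
        linear_combination hst
      rw [this]
      exact R.div_mem (R.neg_mem s.2) t.2
    subst ht
    refine ⟨Subtype.ext (by simpa using hst), rfl⟩
  have : FiniteDimensional R C := Module.finite_of_finrank_pos (by omega)
  have hspan := hli.span_eq_top_of_card_eq_finrank' (by simp [hrank])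
  have hc : c ∈ Submodule.span R (Set.range ![1, ε]) := hspan ▸ Submodule.mem_top
  rw [Matrix.range_cons_cons_empty, Submodule.mem_span_pair] at hc
  obtain ⟨r, s, rfl⟩ := hc
  simp only [Subfield.smul_def, smul_eq_mul, mul_one]
  rw [CharTwo.add_sq, mul_pow]
  exact R.add_mem (R.pow_mem r.2 2) (R.mul_mem (R.pow_mem s.2 2) hε2)

theorem IsSubunital.false_of_charTwo [CharP C 2] {R : Subfield C} {ε : C} (hε : ε ∉ R)
    (hsq : ∀ c : C, c ^ 2 ∈ R) {U : Set (Projectivization C (Fin 3 → C))}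
    (hU : IsSubunital R (RingHom.id C) ε 2 U) : False := by
  have hε0 : ε ≠ 0 := fun h => hε (h ▸ R.zero_mem)
  have : Finite U := Set.finite_of_ncard_ne_zero (by rw [hU.2.1]; norm_num)
  have : Fintype U := Fintype.ofFinite U
  have hcard : Fintype.card U = 9 := by
    rw [← Nat.card_eq_fintype_card, Nat.card_coe_set_eq, hU.2.1]
    norm_num
  have hform (x : U) : unitalForm x.1.rep / ε ∈ R := unitalForm_rep_div_mem hε0 hsq (hU.1 x.2)
  have hform' (r : C) (x : U) : unitalForm (r • x.1.rep) / ε ∈ R := by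
    rw [unitalForm_smul, mul_div_assoc]
    exact R.mul_mem (hsq r) (hform x)
  obtain ⟨m, idem, comm, inv, hdet⟩ := hU.exists_mul_s11
  have hcomb (x y z : U) (hz : m x y = z) (hxy : x ≠ y) (hxz : x ≠ z) (hyz : y ≠ z) :
      ∃ p q : C, p ≠ 0 ∧ q ≠ 0 ∧ z.1.rep = p • x.1.rep + q • y.1.rep :=
    exists_eq_smul_add_smul_of_det_eq_zero (Subtype.coe_ne_coe.2 hxy) (Subtype.coe_ne_coe.2 hxz)
      (Subtype.coe_ne_coe.2 hyz) ((hdet x y hxy z).2 (Or.inr (Or.inr hz.symm)))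
  obtain ⟨a, b, c, d, e, f, g, h, k, hnodup, habe, hacf, hbck, hakd, hceg, hbdg, hbfh, hcdh, hagh,
    hdef⟩ := exists_affinePlane_labelling hcard m idem comm inv
  simp only [List.nodup_cons, List.mem_cons, List.not_mem_nil, or_false, not_or] at hnodup
  obtain ⟨⟨nab, nac, nad, nae, naf, nag, nah, nak⟩,
    ⟨nbc, nbd, nbe, nbf, nbg, nbh, nbk⟩,
    ⟨ncd, nce, ncf, ncg, nch, nck⟩, ⟨nde, ndf, ndg, ndh, ndk⟩,
    ⟨nef, neg, -, -⟩, ⟨-, nfh, -⟩, ⟨ngh, -⟩, -, -⟩ := hnodup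
  have habc : (Matrix.of ![a.1.rep, b.1.rep, c.1.rep]).det ≠ 0 := by
    rw [Ne, hdet a b nab c, habe, not_or, not_or]
    exact ⟨Ne.symm nac, Ne.symm nbc, nce⟩
  obtain ⟨e₁, e₂, he₁, he₂, hE⟩ := hcomb a b e habe nab nae nbe
  obtain ⟨f₁, f₂, hf₁, hf₂, hF⟩ := hcomb a c f hacf nac naf ncf
  obtain ⟨k₁, k₂, hk₁, hk₂, hK⟩ := hcomb b c k hbck nbc nbk nck
  obtain ⟨d₁, d₂, hd₁, hd₂, hD⟩ := hcomb a k d hakd nak nad (Ne.symm ndk)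
  obtain ⟨g₁, g₂, -, -, hG⟩ := hcomb c e g hceg nce ncg neg
  obtain ⟨g₃, g₄, -, hg₄, hG'⟩ := hcomb b d g hbdg nbd nbg ndg
  obtain ⟨h₁, h₂, -, -, hH⟩ := hcomb b f h hbfh nbf nbh nfh
  obtain ⟨h₃, h₄, -, hh₄, hH'⟩ := hcomb c d h hcdh ncd nch ndh
  obtain ⟨s, t, -, -, hAGH⟩ := hcomb a g h hagh nag nah ngh
  obtain ⟨x, y, -, -, hDEF⟩ := hcomb d e f hdef nde ndf nef
  have hβ : d₂ * k₁ ≠ 0 := mul_ne_zero hd₂ hk₁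
  have hγ : d₂ * k₂ ≠ 0 := mul_ne_zero hd₂ hk₂
  obtain ⟨u, hu⟩ : ∃ u, u = d₁ • a.1.rep := ⟨_, rfl⟩
  obtain ⟨v, hv⟩ : ∃ v, v = (d₂ * k₁) • b.1.rep := ⟨_, rfl⟩
  obtain ⟨w, hw⟩ : ∃ w, w = (d₂ * k₂) • c.1.rep := ⟨_, rfl⟩
  have hqu : unitalForm u / ε ∈ R := hu ▸ hform' _ _
  have hqv : unitalForm v / ε ∈ R := hv ▸ hform' _ _
  have hqw : unitalForm w / ε ∈ R := hw ▸ hform' _ _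
  have huvw : (Matrix.of ![u, v, w]).det ≠ 0 := by
    have : (Matrix.of ![u, v, w]).det =
        d₁ * (d₂ * k₁) * (d₂ * k₂) * (Matrix.of ![a.1.rep, b.1.rep, c.1.rep]).det := by
      simp [hu, hv, hw, Matrix.det_fin_three]
      ring
    rw [this]
    exact mul_ne_zero (mul_ne_zero (mul_ne_zero hd₁ hβ) hγ) habc
  have hK' : d₂ • k.1.rep = (1 : C) • v + (1 : C) • w := by
    rw [hK, hv, hw]
    module
  have hD' : d.1.rep = u + v + w := by
    rw [hD, hK', hu]
    module
  rw [← inv_smul_eq_iff₀ hd₁] at hu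
  rw [← inv_smul_eq_iff₀ hβ] at hv
  rw [← inv_smul_eq_iff₀ hγ] at hw
  rw [← hu, smul_smul] at hE hF hAGH
  rw [← hv, smul_smul] at hE hG' hH
  rw [← hw, smul_smul] at hF hG hH'
  have he₁' := mul_ne_zero he₁ (inv_ne_zero hd₁)
  have he₂' := mul_ne_zero he₂ (inv_ne_zero hβ)
  have hf₁' := mul_ne_zero hf₁ (inv_ne_zero hd₁)
  have hf₂' := mul_ne_zero hf₂ (inv_ne_zero hγ)
  obtain ⟨hl, hm⟩ := coeff_ratio_of_affinePlane huvw hD' hE hF hG hG' hH hH' hAGH hDEF he₁' hf₁'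
    hg₄ hh₄
  have hlR : e₂ * (d₂ * k₁)⁻¹ / (e₁ * d₁⁻¹) ∈ R := by
    rw [← eq_sub_iff_add_eq'] at hl
    rw [hl]
    exact R.sub_mem R.one_mem (hsq _)
  have hmR : f₂ * (d₂ * k₂)⁻¹ / (f₁ * d₁⁻¹) ∈ R := by
    rw [hm]
    exact R.add_mem hlR R.one_mem
  refine huvw (det_eq_zero_of_unitalPolar_div_mem hsq hε hqu hqv hqw ?_ ?_ ?_)
  · exact unitalPolar_div_mem hsq he₁' he₂' hlR hqu hqv (hE ▸ hform e)
  · exact unitalPolar_div_mem hsq hf₁' hf₂' hmR hqu hqw (hF ▸ hform f)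
  · exact unitalPolar_div_mem hsq one_ne_zero one_ne_zero (by simp) hqv hqw (hK' ▸ hform' d₂ k)

end

/-- If the quadratic extension `C|R` is inseparable (i.e. `σ = id`), then the
generalized hermitian unital `H(C|R)` contains no subunital of order `2`. -/
theorem no_subunital_order_two_of_inseparable
    {C : Type*} [Field C] (R : Subfield C) (ε t d : C) (σ : C →+* C)
    (hrank : Module.finrank R C = 2)
    (hε : ε ∉ R) (ht : t ∈ R) (hd : d ∈ R)
    (hmin : ε ^ 2 - t * ε + d = 0)
    (hσR : ∀ r ∈ R, σ r = r) (hσε : σ ε = t - ε)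
    (hinsep : σ = RingHom.id C) :
    ¬ ∃ U, IsSubunital R σ ε 2 U := by
  subst hinsep
  rintro ⟨U, hU⟩
  have ht' : t = 2 * ε := by
    rw [RingHom.id_apply] at hσε
    linear_combination -hσε
  have h2 : (2 : C) = 0 := by
    by_contra h2
    refine hε ?_
    have : ε = t / 2 := by
      rw [ht', mul_div_cancel_left₀ _ h2]
    rw [this]
    exact R.div_mem ht (ofNat_mem R 2)
  have : CharP C 2 := CharTwo.of_one_ne_zero_of_two_eq_zero one_ne_zero h2
  have hε2 : ε ^ 2 ∈ R := by
    have : ε ^ 2 = -d := by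
      rw [ht', h2] at hmin
      linear_combination hmin
    rw [this]
    exact R.neg_mem hd
  exact hU.false_of_charTwo hε (sq_mem_of_finrank_eq_two hrank hε hε2)
end
end
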